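/- arXiv:1808.08621 — 5 statements merged into one kernel-verified Lean document; each statement's English description precedes it below -/
import Mathlib

section
/- Let M be a structure in the first-order language L = {∈₁, ∈₂} with two binary relation symbols, and suppose M is a model of ZFC(∈₁) ∪ ZFC(∈₂). Then the ∈₁-reduct (M, ∈₁) and the ∈₂-reduct (M, ∈₂) are isomorphic as {∈}-structures, and moreover the isomorphism is the class function defined in M by an L-formula φ(x,y). -/
universe u

/-! ## Syntax of the first-order language `L = {∈₁, ∈₂}`

Formulas of the first-order language with two binary relation symbols `∈₁`
and `∈₂` (and equality), with variables indexed by `ℕ`. -/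
inductive Fml : Type
  | mem1 : ℕ → ℕ → Fml
  | mem2 : ℕ → ℕ → Fml
  | eq   : ℕ → ℕ → Fml
  | fal  : Fml
  | imp  : Fml → Fml → Fml
  | all  : ℕ → Fml → Fml

/-- Satisfaction of an `L`-formula in a structure `(M, e₁, e₂)` under a
valuation `v : ℕ → M` of the variables. -/
def Fml.Sat {M : Type u} (e₁ e₂ : M → M → Prop) : Fml → (ℕ → M) → Prop
  | .mem1 i j, v => e₁ (v i) (v j)
  | .mem2 i j, v => e₂ (v i) (v j)
  | .eq i j,   v => v i = v j
  | .fal,      _ => False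
  | .imp φ ψ,  v => φ.Sat e₁ e₂ v → ψ.Sat e₁ e₂ v
  | .all n φ,  v => ∀ a : M, φ.Sat e₁ e₂ (Function.update v n a)

/-! ## The ZFC axioms, with membership relation `e`

The Separation and Replacement schemas range over all `L`-formulas, i.e. the
formulas may mention both `∈₁` and `∈₂`; the remaining axioms only mention
the membership relation `e` itself. -/

def Extensionality {M : Type u} (e : M → M → Prop) : Prop :=
  ∀ x y : M, (∀ t, e t x ↔ e t y) → x = y

def Foundation {M : Type u} (e : M → M → Prop) : Prop :=
  ∀ x : M, (∃ t, e t x) → ∃ t, e t x ∧ ∀ s, e s t → ¬ e s x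

def Pairing {M : Type u} (e : M → M → Prop) : Prop :=
  ∀ x y : M, ∃ p : M, ∀ t, e t p ↔ (t = x ∨ t = y)

def UnionAx {M : Type u} (e : M → M → Prop) : Prop :=
  ∀ x : M, ∃ u : M, ∀ t, e t u ↔ ∃ s, e s x ∧ e t s

def PowerSetAx {M : Type u} (e : M → M → Prop) : Prop :=
  ∀ x : M, ∃ p : M, ∀ t, e t p ↔ ∀ s, e s t → e s x

def InfinityAx {M : Type u} (e : M → M → Prop) : Prop :=
  ∃ w : M, (∃ z, e z w ∧ ∀ t, ¬ e t z) ∧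
    ∀ t, e t w → ∃ s, e s w ∧ ∀ u, e u s ↔ (e u t ∨ u = t)

/-- The axiom of choice: every set of nonempty pairwise disjoint sets has a
choice set. -/
def ChoiceAx {M : Type u} (e : M → M → Prop) : Prop :=
  ∀ x : M, (∀ t, e t x → ∃ s, e s t) →
    (∀ t t', e t x → e t' x → t ≠ t' → ¬ ∃ s, e s t ∧ e s t') →
    ∃ c : M, ∀ t, e t x → ∃! s, e s t ∧ e s c

/-- The Separation Schema for the membership relation `e`, where the
formulas range over all `L`-formulas (interpreted with `∈₁ := e₁`,
`∈₂ := e₂`) and may use parameters (supplied by the valuation `v`);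
variable `0` is the variable being separated on. -/
def SeparationSchema {M : Type u} (e e₁ e₂ : M → M → Prop) : Prop :=
  ∀ (φ : Fml) (v : ℕ → M) (a : M), ∃ b : M,
    ∀ t : M, e t b ↔ (e t a ∧ φ.Sat e₁ e₂ (Function.update v 0 t))

/-- The Replacement Schema for the membership relation `e`, where the
formulas range over all `L`-formulas (interpreted with `∈₁ := e₁`,
`∈₂ := e₂`) and may use parameters; variables `0` and `1` are the
argument/value variables of the class function defined by `φ`. -/
def ReplacementSchema {M : Type u} (e e₁ e₂ : M → M → Prop) : Prop :=
  ∀ (φ : Fml) (v : ℕ → M) (a : M),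
    (∀ t, e t a → ∃! s, φ.Sat e₁ e₂ (Function.update (Function.update v 0 t) 1 s)) →
    ∃ b : M, ∀ t, e t a → ∀ s,
      φ.Sat e₁ e₂ (Function.update (Function.update v 0 t) 1 s) → e s b

/-- A model `(M, ∈₁, ∈₂)` of `ZFC(∈₁) ∪ ZFC(∈₂)`: the first-order ZFC axioms
hold for the membership relation `∈₁`, with the Separation and Replacement
schemas ranging over all formulas of the language `L = {∈₁, ∈₂}`, and
likewise for the membership relation `∈₂`. -/
structure ZFC2Model (M : Type u) : Type u where
  mem1 : M → M → Prop
  mem2 : M → M → Prop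
  ext1 : Extensionality mem1
  found1 : Foundation mem1
  pair1 : Pairing mem1
  union1 : UnionAx mem1
  power1 : PowerSetAx mem1
  infinity1 : InfinityAx mem1
  choice1 : ChoiceAx mem1
  sep1 : SeparationSchema mem1 mem1 mem2
  repl1 : ReplacementSchema mem1 mem1 mem2
  ext2 : Extensionality mem2
  found2 : Foundation mem2
  pair2 : Pairing mem2
  union2 : UnionAx mem2
  power2 : PowerSetAx mem2
  infinity2 : InfinityAx mem2
  choice2 : ChoiceAx mem2
  sep2 : SeparationSchema mem2 mem1 mem2
  repl2 : ReplacementSchema mem2 mem1 mem2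

/-! ## Defined notions, relative to a membership relation `e` -/

/-- `u` is a transitive set in the sense of `e`. -/
def IsTransSet {M : Type u} (e : M → M → Prop) (x : M) : Prop :=
  ∀ t, e t x → ∀ w, e w t → e w x

/-- `u` is the `e`-transitive closure `TC(x)` of `x`: the least transitive
set containing all `e`-elements of `x`. -/
def IsTC {M : Type u} (e : M → M → Prop) (x u : M) : Prop :=
  IsTransSet e u ∧ (∀ v, e v x → e v u) ∧
    ∀ v, IsTransSet e v → (∀ w, e w x → e w v) → ∀ w, e w u → e w v

/-- `s` is the singleton `{x}` in the sense of `e`. -/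
def IsSingleton {M : Type u} (e : M → M → Prop) (x s : M) : Prop :=
  ∀ t, e t s ↔ t = x

/-- `p` is the (Kuratowski) ordered pair `⟨a, b⟩ = {{a}, {a, b}}` in the
sense of `e`. -/
def IsOPair {M : Type u} (e : M → M → Prop) (a b p : M) : Prop :=
  ∃ sa pab : M, IsSingleton e a sa ∧ (∀ t, e t pab ↔ (t = a ∨ t = b)) ∧
    (∀ t, e t p ↔ (t = sa ∨ t = pab))

/-- `f(a) = b` in the sense of `e`: the ordered pair `⟨a, b⟩` is an
`e`-element of `f`. -/
def FunVal {M : Type u} (e : M → M → Prop) (f a b : M) : Prop :=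
  ∃ p, e p f ∧ IsOPair e a b p

/-- In the sense of `e`, the set `f` is a function with domain `d`. -/
def IsFuncOn {M : Type u} (e : M → M → Prop) (f d : M) : Prop :=
  (∀ p, e p f → ∃ a b, e a d ∧ IsOPair e a b p) ∧
  (∀ a, e a d → ∃ b, FunVal e f a b) ∧
  (∀ a b b', FunVal e f a b → FunVal e f a b' → b = b')

/-- `On(α)` in the sense of `e`: `α` is an ordinal, i.e. a transitive set of
transitive sets. -/
def IsOrd {M : Type u} (e : M → M → Prop) (α : M) : Prop :=
  IsTransSet e α ∧ ∀ t, e t α → IsTransSet e t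

/-- `v = V_α`, the `α`-th level of the cumulative hierarchy in the sense of
`e`: there is a function `g` (in the sense of `e`) with domain `α ∪ {α}`
such that `g(β) = { t : t ⊆ g(γ) for some γ ∈ β }` for every `β ∈ α ∪ {α}`,
and `v = g(α)`. -/
def IsVLevel {M : Type u} (e : M → M → Prop) (α v : M) : Prop :=
  ∃ g s : M, (∀ t, e t s ↔ (e t α ∨ t = α)) ∧ IsFuncOn e g s ∧
    (∀ β, e β s → ∀ gβ, FunVal e g β gβ → ∀ t,
      (e t gβ ↔ ∃ γ, e γ β ∧ ∃ gγ, FunVal e g γ gγ ∧ ∀ w, e w t → e w gγ)) ∧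
    FunVal e g α v

/-! ## The formulas `ψ(x, y, f)` and `φ(x, y)` -/

/-- The formula `ψ(x, y, f)` of Väänänen's paper, asserting that (i) in the
sense of `∈₁`, `f` is a function with domain `TC₁({x})`; (ii) `f` maps
`TC₁(x)` into `TC₂(y)`; (iii) `f` maps `TC₁(x)` onto `TC₂(y)`; (iv) for all
`t ∈₁ TC₁(x)` and `w ∈₁ TC₁({x})`, `t ∈₁ w ↔ f(t) ∈₂ f(w)`; and (v)
`f(x) = y`.  (Here `f` is applied in the sense of `∈₁`.) -/
def Psi {M : Type u} (e₁ e₂ : M → M → Prop) (x y f : M) : Prop :=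
  ∃ sx tcsx tcx tcy : M,
    IsSingleton e₁ x sx ∧ IsTC e₁ sx tcsx ∧ IsTC e₁ x tcx ∧ IsTC e₂ y tcy ∧
    -- (i)
    IsFuncOn e₁ f tcsx ∧
    -- (ii)
    (∀ t, e₁ t tcx → ∀ ft, FunVal e₁ f t ft → e₂ ft tcy) ∧
    -- (iii)
    (∀ t, e₂ t tcy → ∃ w, e₁ w tcx ∧ FunVal e₁ f w t) ∧
    -- (iv)
    (∀ t, e₁ t tcx → ∀ w, e₁ w tcsx → ∀ ft fw,
      FunVal e₁ f t ft → FunVal e₁ f w fw → (e₁ t w ↔ e₂ ft fw)) ∧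
    -- (v)
    FunVal e₁ f x y

/-- The formula `φ(x, y) := ∃f ψ(x, y, f)`. -/
def Phi {M : Type u} (e₁ e₂ : M → M → Prop) (x y : M) : Prop :=
  ∃ f, Psi e₁ e₂ x y f

section Zer

/-- Definability (without parameters) of a predicate on `n`-tuples. -/
class Df {M : Type u} (e1 e2 : M → M → Prop) (n : ℕ) (P : (Fin n → M) → Prop) : Prop where
  out : ∃ φ : Fml, ∀ v : ℕ → M, φ.Sat e1 e2 v ↔ P (fun i => v i)

/-- Definability of a binary relation. -/
class Df2 {M : Type u} (e1 e2 : M → M → Prop) (R : M → M → Prop) : Prop where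
  out : ∀ n (i j : Fin n), Df e1 e2 n (fun w => R (w i) (w j))

variable {M : Type u} {e1 e2 : M → M → Prop} {n : ℕ}

instance Df.bin (R : M → M → Prop) [h : Df2 e1 e2 R] (i j : Fin n) :
    Df e1 e2 n (fun w => R (w i) (w j)) := h.out n i j

instance Df.eq (i j : Fin n) : Df e1 e2 n (fun w => w i = w j) :=
  ⟨.eq i j, fun v => Iff.rfl⟩

theorem Df2.m1 : Df2 e1 e2 e1 := ⟨fun _ i j => ⟨.mem1 i j, fun v => Iff.rfl⟩⟩
theorem Df2.m2 : Df2 e1 e2 e2 := ⟨fun _ i j => ⟨.mem2 i j, fun v => Iff.rfl⟩⟩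

instance Df.imp (P Q : (Fin n → M) → Prop) [hP : Df e1 e2 n P] [hQ : Df e1 e2 n Q] :
    Df e1 e2 n (fun w => P w → Q w) := by
  obtain ⟨φ, hφ⟩ := hP
  obtain ⟨ψ, hψ⟩ := hQ
  exact ⟨.imp φ ψ, fun v => by simp only [Fml.Sat, hφ, hψ]⟩

instance Df.not (P : (Fin n → M) → Prop) [hP : Df e1 e2 n P] :
    Df e1 e2 n (fun w => ¬ P w) := by
  obtain ⟨φ, hφ⟩ := hP
  exact ⟨.imp φ .fal, fun v => by simp only [Fml.Sat, hφ]⟩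

theorem Df.congr {P Q : (Fin n → M) → Prop} (hP : Df e1 e2 n P) (h : ∀ w, P w ↔ Q w) :
    Df e1 e2 n Q := by
  have : P = Q := funext fun w => propext (h w)
  exact this ▸ hP

instance Df.and (P Q : (Fin n → M) → Prop) [hP : Df e1 e2 n P] [hQ : Df e1 e2 n Q] :
    Df e1 e2 n (fun w => P w ∧ Q w) :=
  Df.congr (Df.not (fun w => P w → ¬ Q w)) fun w => by tauto

instance Df.or (P Q : (Fin n → M) → Prop) [hP : Df e1 e2 n P] [hQ : Df e1 e2 n Q] :
    Df e1 e2 n (fun w => P w ∨ Q w) :=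
  Df.congr (Df.imp (fun w => ¬ P w) Q) fun w => by tauto

instance Df.iff (P Q : (Fin n → M) → Prop) [hP : Df e1 e2 n P] [hQ : Df e1 e2 n Q] :
    Df e1 e2 n (fun w => P w ↔ Q w) :=
  Df.congr (Df.and (fun w => P w → Q w) (fun w => Q w → P w)) fun w => by tauto

instance Df.all (P : M → (Fin n → M) → Prop)
    [hP : Df e1 e2 (n+1) (fun w => P (w (Fin.last n)) (fun i => w i.castSucc))] :
    Df e1 e2 n (fun w => ∀ a, P a w) := by
  obtain ⟨φ, hφ⟩ := hP
  refine ⟨.all n φ, fun v => ?_⟩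
  simp only [Fml.Sat, hφ]
  refine forall_congr' fun a => ?_
  have h1 : (Function.update v n a) ((Fin.last n : Fin (n+1)) : ℕ) = a := by simp
  have h2 : (fun i : Fin n => (Function.update v n a) ((i.castSucc : Fin (n+1)) : ℕ))
      = fun i : Fin n => v i := by
    funext i
    have : (i : ℕ) ≠ n := i.isLt.ne
    simp [this]
  rw [h1, h2]

instance Df.ex (P : M → (Fin n → M) → Prop)
    [hP : Df e1 e2 (n+1) (fun w => P (w (Fin.last n)) (fun i => w i.castSucc))] :
    Df e1 e2 n (fun w => ∃ a, P a w) :=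
  Df.congr (Df.not (fun w => ∀ a, ¬ P a w)) fun w => by simp

section defs
variable (e : M → M → Prop) [Df2 e1 e2 e]

instance dTrans (i : Fin n) : Df e1 e2 n (fun w => IsTransSet e (w i)) := by
  unfold IsTransSet; infer_instance
instance dOrd (i : Fin n) : Df e1 e2 n (fun w => IsOrd e (w i)) := by
  unfold IsOrd; infer_instance
instance dSing (i j : Fin n) : Df e1 e2 n (fun w => IsSingleton e (w i) (w j)) := by
  unfold IsSingleton; infer_instance
instance dOPair (i j k : Fin n) : Df e1 e2 n (fun w => IsOPair e (w i) (w j) (w k)) := by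
  unfold IsOPair; infer_instance
instance dFunVal (i j k : Fin n) : Df e1 e2 n (fun w => FunVal e (w i) (w j) (w k)) := by
  unfold FunVal; infer_instance
end defs

/-- ZF for `e` with schemas over all definable predicates. -/
structure ZG (e1 e2 e : M → M → Prop) : Prop where
  de : Df2 e1 e2 e
  ext : Extensionality e
  found : Foundation e
  pair : Pairing e
  union : UnionAx e
  power : PowerSetAx e
  inf : InfinityAx e
  sepS : SeparationSchema e e1 e2
  replS : ReplacementSchema e e1 e2

/-- Uniform definability of a unary predicate with parameters. -/
abbrev DU (e1 e2 : M → M → Prop) {n : ℕ} (P : M → (Fin n → M) → Prop) : Prop :=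
  ∀ (m : ℕ) (i : Fin m) (σ : Fin n → Fin m), Df e1 e2 m (fun w => P (w i) (fun k => w (σ k)))

/-- Uniform definability of a binary predicate with parameters. -/
abbrev DB (e1 e2 : M → M → Prop) {n : ℕ} (P : M → M → (Fin n → M) → Prop) : Prop :=
  ∀ (m : ℕ) (i j : Fin m) (σ : Fin n → Fin m),
    Df e1 e2 m (fun w => P (w i) (w j) (fun k => w (σ k)))

namespace ZG
variable {e : M → M → Prop} (Z : ZG e1 e2 e)
include Z

theorem sep (P : M → (Fin n → M) → Prop) (hP : DU e1 e2 P) (p : Fin n → M) (a : M) :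
    ∃ b, ∀ t, e t b ↔ e t a ∧ P t p := by
  obtain ⟨φ, hφ⟩ := hP (n+1) 0 Fin.succ
  obtain ⟨b, hb⟩ := Z.sepS φ (fun k => if h : k - 1 < n then p ⟨k-1, h⟩ else a) a
  refine ⟨b, fun t => ?_⟩
  rw [hb, hφ]
  simp

theorem repl (P : M → M → (Fin n → M) → Prop) (hP : DB e1 e2 P) (p : Fin n → M) (a : M)
    (h : ∀ t, e t a → ∃! s, P t s p) : ∃ b, ∀ t, e t a → ∀ s, P t s p → e s b := by
  obtain ⟨φ, hφ⟩ := hP (n+2) 0 1 (fun k => k.succ.succ)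
  have key : ∀ t s, φ.Sat e1 e2 (Function.update (Function.update
      (fun k => if h : k - 2 < n then p ⟨k-2, h⟩ else a) 0 t) 1 s) ↔ P t s p := by
    intro t s
    rw [hφ]
    simp [Function.update]
  obtain ⟨b, hb⟩ := Z.replS φ (fun k => if h : k - 2 < n then p ⟨k-2, h⟩ else a) a
    (by simpa only [key] using h)
  exact ⟨b, by simpa only [key] using hb⟩

theorem img (P : M → M → (Fin n → M) → Prop) (hP : DB e1 e2 P) (p : Fin n → M) (a : M)
    (h : ∀ t, e t a → ∀ s s', P t s p → P t s' p → s = s') :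
    ∃ b, ∀ s, e s b ↔ ∃ t, e t a ∧ P t s p := by
  have := Z.de
  obtain ⟨a', ha'⟩ := Z.sep (fun t w => ∃ s, P t s w) (fun m i σ => by
    have := fun i j => hP (m+1) i j (fun k => (σ k).castSucc)
    infer_instance) p a
  obtain ⟨b, hb⟩ := Z.repl P hP p a' (by
    intro t ht
    obtain ⟨h1, s, hs⟩ := (ha' t).1 ht
    exact ⟨s, hs, fun s' hs' => h t h1 _ _ hs' hs⟩)
  obtain ⟨c, hc⟩ := Z.sep (n := n+1) (fun s w => ∃ t, e t (w 0) ∧ P t s (fun i => w i.succ))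
    (fun m i σ => by
      have := fun i j => hP (m+1) i j (fun k => (σ k.succ).castSucc)
      infer_instance) (Fin.cons a p) b
  refine ⟨c, fun s => ?_⟩
  rw [hc]
  simp only [Fin.cons_zero, Fin.cons_succ]
  constructor
  · exact fun h => h.2
  · rintro ⟨t, ht, hs⟩
    exact ⟨hb t ((ha' t).2 ⟨ht, s, hs⟩) s hs, t, ht, hs⟩

theorem sing (a : M) : ∃ s, ∀ t, e t s ↔ t = a := by
  obtain ⟨s, hs⟩ := Z.pair a a
  exact ⟨s, by simpa using hs⟩

theorem opair_ex (a b : M) : ∃ p, IsOPair e a b p := by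
  obtain ⟨s, hs⟩ := Z.sing a
  obtain ⟨q, hq⟩ := Z.pair a b
  obtain ⟨p, hp⟩ := Z.pair s q
  exact ⟨p, s, q, hs, hq, hp⟩

theorem opair_uniq {a b p p' : M} (h : IsOPair e a b p) (h' : IsOPair e a b p') : p = p' := by
  obtain ⟨s, q, hs, hq, hp⟩ := h
  obtain ⟨s', q', hs', hq', hp'⟩ := h'
  have h1 : s = s' := Z.ext _ _ fun t => by rw [hs t, hs' t]
  have h2 : q = q' := Z.ext _ _ fun t => by rw [hq t, hq' t]
  subst h1 h2
  exact Z.ext _ _ fun t => by rw [hp t, hp' t]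

theorem opair_inj {a b a' b' p : M} (h : IsOPair e a b p) (h' : IsOPair e a' b' p) :
    a = a' ∧ b = b' := by
  obtain ⟨s, q, hs, hq, hp⟩ := h
  obtain ⟨s', q', hs', hq', hp'⟩ := h'
  have hsp := (hp' s).1 ((hp s).2 (Or.inl rfl))
  have hqp := (hp' q).1 ((hp q).2 (Or.inr rfl))
  have hqp' := (hp q').1 ((hp' q').2 (Or.inr rfl))
  have haa : a = a' := by
    rcases hsp with h | h
    · exact (hs' a).1 (h ▸ (hs a).2 rfl)
    · exact ((hs a').1 (h ▸ (hq' a').2 (Or.inl rfl))).symm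
  subst haa
  refine ⟨rfl, ?_⟩
  have hb : b = a ∨ b = b' := by
    rcases hqp with h | h
    · exact Or.inl ((hs' b).1 (h ▸ (hq b).2 (Or.inr rfl)))
    · exact (hq' b).1 (h ▸ (hq b).2 (Or.inr rfl))
  have hb' : b' = a ∨ b' = b := by
    rcases hqp' with h | h
    · exact Or.inl ((hs b').1 (h ▸ (hq' b').2 (Or.inr rfl)))
    · exact (hq b').1 (h ▸ (hq' b').2 (Or.inr rfl))
  rcases hb with h | h
  · rcases hb' with h' | h'
    · rw [h, h']
    · exact h'.symm
  · exact h

theorem graph (P : M → M → (Fin n → M) → Prop) (hP : DB e1 e2 P) (p : Fin n → M) (a : M)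
    (h : ∀ t, e t a → ∀ s s', P t s p → P t s' p → s = s') :
    ∃ g, (∀ q, e q g → ∃ t s, e t a ∧ IsOPair e t s q) ∧
      ∀ t s, FunVal e g t s ↔ e t a ∧ P t s p := by
  have := Z.de
  obtain ⟨g, hg⟩ := Z.img (fun t z w => ∃ s, P t s w ∧ IsOPair e t s z) (fun m i j σ => by
    have := fun i j => hP (m+1) i j (fun k => (σ k).castSucc)
    infer_instance) p a (by
    rintro t ht z z' ⟨s, hs, hz⟩ ⟨s', hs', hz'⟩
    obtain rfl := h t ht _ _ hs hs'
    exact Z.opair_uniq hz hz')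
  refine ⟨g, ?_, ?_⟩
  · intro q hq
    obtain ⟨t, ht, s, hs, hz⟩ := (hg q).1 hq
    exact ⟨t, s, ht, hz⟩
  · intro t s
    constructor
    · rintro ⟨q, hq, hts⟩
      obtain ⟨t', ht', s', hs', hz⟩ := (hg q).1 hq
      obtain ⟨rfl, rfl⟩ := Z.opair_inj hz hts
      exact ⟨ht', hs'⟩
    · rintro ⟨ht, hs⟩
      obtain ⟨q, hq⟩ := Z.opair_ex t s
      exact ⟨q, (hg q).2 ⟨t, ht, s, hs, hq⟩, hq⟩

theorem cup (a b : M) : ∃ c, ∀ t, e t c ↔ e t a ∨ e t b := by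
  obtain ⟨q, hq⟩ := Z.pair a b
  obtain ⟨u, hu⟩ := Z.union q
  refine ⟨u, fun t => ?_⟩
  rw [hu]
  simp only [hq]
  constructor
  · rintro ⟨s, rfl | rfl, h⟩ <;> tauto
  · rintro (h | h)
    · exact ⟨a, Or.inl rfl, h⟩
    · exact ⟨b, Or.inr rfl, h⟩

theorem relgraph (P : M → M → (Fin n → M) → Prop) (hP : DB e1 e2 P) (p : Fin n → M) (a b : M) :
    ∃ g, ∀ t s, FunVal e g t s ↔ e t a ∧ e s b ∧ P t s p := by
  have := Z.de
  obtain ⟨c, hc⟩ := Z.cup a b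
  obtain ⟨c1, hc1⟩ := Z.power c
  obtain ⟨c2, hc2⟩ := Z.power c1
  obtain ⟨g, hg⟩ := Z.sep (n := n+2)
    (fun z w => ∃ t s, IsOPair e t s z ∧ e t (w 0) ∧ e s (w 1) ∧ P t s (fun i => w i.succ.succ))
    (fun m i σ => by
      have := fun i j => hP (m+1+1) i j (fun k => (σ k.succ.succ).castSucc.castSucc)
      infer_instance) (Fin.cons a (Fin.cons b p)) c2
  have hg' : ∀ z, e z g ↔ e z c2 ∧ ∃ t s, IsOPair e t s z ∧ e t a ∧ e s b ∧ P t s p := hg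
  refine ⟨g, fun t s => ⟨?_, ?_⟩⟩
  · rintro ⟨q, hq, hts⟩
    obtain ⟨-, t', s', hz, h⟩ := (hg' q).1 hq
    obtain ⟨rfl, rfl⟩ := Z.opair_inj hz hts
    exact h
  · rintro ⟨ht, hs, h⟩
    obtain ⟨q, hq⟩ := Z.opair_ex t s
    refine ⟨q, (hg' q).2 ⟨?_, t, s, hq, ht, hs, h⟩, hq⟩
    obtain ⟨sa, pab, h1, h2, h3⟩ := hq
    rw [hc2]
    intro r hr
    rw [hc1]
    intro z hz
    rw [hc]
    rcases (h3 r).1 hr with rfl | rfl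
    · rw [(h1 z).1 hz]; exact Or.inl ht
    · rcases (h2 z).1 hz with rfl | rfl
      · exact Or.inl ht
      · exact Or.inr hs

theorem setind (P : M → (Fin n → M) → Prop) (hP : DU e1 e2 P) (p : Fin n → M) (d : M)
    (h : ∀ k, e k d → (∀ j, e j k → e j d → P j p) → P k p) : ∀ k, e k d → P k p := by
  by_contra hc
  push Not at hc
  obtain ⟨k, hk, hkP⟩ := hc
  obtain ⟨b, hb⟩ := Z.sep (fun t w => ¬ P t w) (fun m i σ => by
    have := hP m i σ
    infer_instance) p d
  obtain ⟨t, ht, hmin⟩ := Z.found b ⟨k, (hb k).2 ⟨hk, hkP⟩⟩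
  obtain ⟨h1, h2⟩ := (hb t).1 ht
  refine h2 (h t h1 fun j hj hjd => ?_)
  by_contra hn
  exact hmin j hj ((hb j).2 ⟨hjd, hn⟩)

theorem omega : ∃ o, (∃ k, e k o) ∧ (∀ k, e k o → ∃ k', e k' o ∧ e k k') ∧ IsOrd e o := by
  have := Z.de
  obtain ⟨w, ⟨z, hz, hz'⟩, hw⟩ := Z.inf
  obtain ⟨o, ho⟩ := Z.sep (fun k v => IsOrd e k ∧ ∀ j, e j k → e j (v 0))
    (fun m i σ => by infer_instance) ![w] w
  have ho : ∀ k, e k o ↔ e k w ∧ IsOrd e k ∧ ∀ j, e j k → e j w := ho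
  refine ⟨o, ⟨z, (ho z).2 ⟨hz, ⟨fun t ht => (hz' t ht).elim, fun t ht => (hz' t ht).elim⟩,
    fun t ht => (hz' t ht).elim⟩⟩, ?_, ?_, ?_⟩
  · intro k hk
    obtain ⟨h1, ⟨h2, h3⟩, h4⟩ := (ho k).1 hk
    obtain ⟨s, hs, hs'⟩ := hw k h1
    refine ⟨s, (ho s).2 ⟨hs, ⟨?_, ?_⟩, ?_⟩, (hs' k).2 (Or.inr rfl)⟩
    · intro t ht r hr
      rw [hs'] at ht ⊢
      rcases ht with ht | rfl
      · exact Or.inl (h2 t ht r hr)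
      · exact Or.inl hr
    · intro t ht
      rcases (hs' t).1 ht with ht | rfl
      · exact h3 t ht
      · exact h2
    · intro t ht
      rcases (hs' t).1 ht with ht | rfl
      · exact h4 t ht
      · exact h1
  · intro k hk j hj
    obtain ⟨h1, ⟨h2, h3⟩, h4⟩ := (ho k).1 hk
    exact (ho j).2 ⟨h4 j hj, ⟨h3 j hj, fun t ht => h3 t (h2 j hj t ht)⟩,
      fun t ht => h4 t (h2 j hj t ht)⟩
  · intro k hk
    exact ((ho k).1 hk).2.1.1

end ZG

/-- `y` is the value at `k` computed from the values of `g` below `k`. -/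
def Hd (e : M → M → Prop) (x g k y : M) : Prop :=
  ∀ t, e t y ↔ (e t x ∨ ∃ i, e i k ∧ ∃ w, FunVal e g i w ∧ ∃ s, e s w ∧ e t s)

/-- `g` is a correct recursive computation below `k`. -/
def Att (e : M → M → Prop) (x k g : M) : Prop :=
  ∀ j, e j k → ∀ z, FunVal e g j z ↔ Hd e x g j z

/-- `y` is the value of the recursion at `k`. -/
def Rr (e : M → M → Prop) (x k y : M) : Prop := ∃ g, Att e x k g ∧ Hd e x g k y

section defs
variable (e : M → M → Prop) [Df2 e1 e2 e]
instance dHd (i j k l : Fin n) : Df e1 e2 n (fun w => Hd e (w i) (w j) (w k) (w l)) := by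
  unfold Hd; infer_instance
instance dAtt (i j k : Fin n) : Df e1 e2 n (fun w => Att e (w i) (w j) (w k)) := by
  unfold Att; infer_instance
instance dRr (i j k : Fin n) : Df e1 e2 n (fun w => Rr e (w i) (w j) (w k)) := by
  unfold Rr; infer_instance
end defs

namespace ZG
variable {e : M → M → Prop} (Z : ZG e1 e2 e)
include Z

omit Z in
theorem hd_congr {x g g' k y : M} (h : ∀ i, e i k → ∀ w, FunVal e g i w ↔ FunVal e g' i w)
    (hy : Hd e x g k y) : Hd e x g' k y := by
  intro t
  rw [hy t]
  refine or_congr Iff.rfl (exists_congr fun i => ?_)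
  refine and_congr_right fun hi => exists_congr fun w => and_congr_left' (h i hi w)

theorem hd_uniq {x g k y y' : M} (h : Hd e x g k y) (h' : Hd e x g k y') : y = y' :=
  Z.ext _ _ fun t => by rw [h t, h' t]

theorem att_agree {x k g g' : M} (hk : IsTransSet e k) (h : Att e x k g) (h' : Att e x k g') :
    ∀ j, e j k → ∀ z, FunVal e g j z ↔ FunVal e g' j z := by
  have := Z.de
  refine Z.setind (fun j w => ∀ z, FunVal e (w 0) j z ↔ FunVal e (w 1) j z)
    (fun m i σ => by infer_instance) ![g, g'] k ?_
  intro j hj ih z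
  have ih : ∀ i, e i j → ∀ z, FunVal e g i z ↔ FunVal e g' i z := fun i hi => ih i hi (hk j hj i hi)
  show FunVal e g j z ↔ FunVal e g' j z
  rw [h j hj, h' j hj]
  exact ⟨hd_congr ih, hd_congr fun i hi w => (ih i hi w).symm⟩

theorem rr_uniq {x k y y' : M} (hk : IsTransSet e k) (h : Rr e x k y) (h' : Rr e x k y') :
    y = y' := by
  obtain ⟨g, hg, hy⟩ := h
  obtain ⟨g', hg', hy'⟩ := h'
  exact Z.hd_uniq (hd_congr (Z.att_agree hk hg hg') hy) hy'

theorem att_rr {x k g : M} (hk : IsOrd e k) (hg : Att e x k g) :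
    ∀ j, e j k → ∀ z, FunVal e g j z ↔ Rr e x j z := by
  intro j hj z
  have hgj : Att e x j g := fun i hi => hg i (hk.1 j hj i hi)
  constructor
  · exact fun h => ⟨g, hgj, (hg j hj z).1 h⟩
  · rintro ⟨g0, h0, hz⟩
    exact (hg j hj z).2 (hd_congr (Z.att_agree (hk.2 j hj) h0 hgj) hz)

theorem trans_sup (x : M) : ∃ u, IsTransSet e u ∧ ∀ t, e t x → e t u := by
  have := Z.de
  obtain ⟨o, ⟨k0, hk0⟩, hmax, hot, hoo⟩ := Z.omega
  have hord : ∀ k, e k o → IsOrd e k := fun k hk =>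
    ⟨hoo k hk, fun t ht => hoo t (hot k hk t ht)⟩
  have hex : ∀ k, e k o → ∃ y, Rr e x k y := by
    refine Z.setind (fun k w => ∃ y, Rr e (w 0) k y) (fun m i σ => by infer_instance) ![x] o ?_
    intro k hk ih
    have ih : ∀ j, e j k → ∃ y, Rr e x j y := fun j hj => ih j hj (hot k hk j hj)
    show ∃ y, Rr e x k y
    have hfun : ∀ j, e j k → ∀ s s', Rr e x j s → Rr e x j s' → s = s' :=
      fun j hj s s' => Z.rr_uniq ((hord k hk).2 j hj)
    obtain ⟨g, -, hg⟩ := Z.graph (fun j y w => Rr e (w 0) j y)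
      (fun m i j σ => by infer_instance) ![x] k hfun
    have hg : ∀ t s, FunVal e g t s ↔ e t k ∧ Rr e x t s := hg
    have hatt : Att e x k g := by
      intro j hj z
      rw [hg]
      have hag : ∀ g', Att e x j g' → ∀ i, e i j → ∀ w, FunVal e g' i w ↔ FunVal e g i w := by
        intro g' hg' i hi w
        rw [hg, Z.att_rr (hord j (hot k hk j hj)) hg' i hi]
        exact ⟨fun h => ⟨(hord k hk).1 j hj i hi, h⟩, fun h => h.2⟩
      constructor
      · rintro ⟨-, g', hg', hz⟩
        exact hd_congr (hag g' hg') hz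
      · intro hz
        obtain ⟨y, hy⟩ := ih j hj
        have hy' := hy
        obtain ⟨g', hg', hz'⟩ := hy'
        obtain rfl := Z.hd_uniq (hd_congr (hag g' hg') hz') hz
        exact ⟨hj, hy⟩
    obtain ⟨b, hb⟩ := Z.img (fun j y w => Rr e (w 0) j y)
      (fun m i j σ => by infer_instance) ![x] k hfun
    have hb : ∀ s, e s b ↔ ∃ t, e t k ∧ Rr e x t s := hb
    obtain ⟨b1, hb1⟩ := Z.union b
    obtain ⟨b2, hb2⟩ := Z.union b1
    obtain ⟨y, hy⟩ := Z.cup x b2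
    refine ⟨y, g, hatt, fun t => ?_⟩
    rw [hy]
    refine or_congr Iff.rfl ?_
    simp only [hb2, hb1, hb, hg]
    constructor
    · rintro ⟨s, ⟨w, ⟨i, hi, hr⟩, hs⟩, ht⟩
      exact ⟨i, hi, w, ⟨hi, hr⟩, s, hs, ht⟩
    · rintro ⟨i, hi, w, ⟨-, hr⟩, s, hs, ht⟩
      exact ⟨s, ⟨w, ⟨i, hi, hr⟩, hs⟩, ht⟩
  obtain ⟨b, hb⟩ := Z.img (fun j y w => Rr e (w 0) j y)
    (fun m i j σ => by infer_instance) ![x] o (fun j hj s s' => Z.rr_uniq (hoo j hj))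
  have hb : ∀ s, e s b ↔ ∃ t, e t o ∧ Rr e x t s := hb
  obtain ⟨u, hu⟩ := Z.union b
  refine ⟨u, ?_, ?_⟩
  · intro s hs t ht
    obtain ⟨y, hy, hsy⟩ := (hu s).1 hs
    obtain ⟨k, hk, hr⟩ := (hb y).1 hy
    obtain ⟨k', hk', hkk⟩ := hmax k hk
    obtain ⟨y', hr'⟩ := hex k' hk'
    refine (hu t).2 ⟨y', (hb y').2 ⟨k', hk', hr'⟩, ?_⟩
    obtain ⟨g, hg, hd⟩ := hr'
    exact (hd t).2 (Or.inr ⟨k, hkk, y, (Z.att_rr (hord k' hk') hg k hkk y).2 hr, s, hsy, ht⟩)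
  · intro t ht
    obtain ⟨y, hr⟩ := hex k0 hk0
    refine (hu t).2 ⟨y, (hb y).2 ⟨k0, hk0, hr⟩, ?_⟩
    obtain ⟨g, hg, hd⟩ := hr
    exact (hd t).2 (Or.inl ht)

theorem trans_mem (x : M) : ∃ u, IsTransSet e u ∧ e x u := by
  obtain ⟨s, hs⟩ := Z.sing x
  obtain ⟨u, hu, h⟩ := Z.trans_sup s
  exact ⟨u, hu, h x ((hs x).2 rfl)⟩

theorem tc_ex (x : M) : ∃ u, IsTC e x u := by
  have := Z.de
  obtain ⟨u0, hu0, h0⟩ := Z.trans_sup x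
  obtain ⟨u, hu⟩ := Z.sep
    (fun t w => ∀ v, IsTransSet e v → (∀ r, e r (w 0) → e r v) → e t v)
    (fun m i σ => by infer_instance) ![x] u0
  have hu : ∀ t, e t u ↔ e t u0 ∧ ∀ v, IsTransSet e v → (∀ r, e r x → e r v) → e t v := hu
  refine ⟨u, ?_, ?_, ?_⟩
  · intro t ht w hw
    obtain ⟨h1, h2⟩ := (hu t).1 ht
    exact (hu w).2 ⟨hu0 t h1 w hw, fun v hv hx => hv t (h2 v hv hx) w hw⟩
  · intro t ht
    exact (hu t).2 ⟨h0 t ht, fun v _ hx => hx t ht⟩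
  · intro v hv hx w hw
    exact ((hu w).1 hw).2 v hv hx

theorem ind (P : M → (Fin n → M) → Prop) (hP : DU e1 e2 P) (p : Fin n → M)
    (h : ∀ k, (∀ j, e j k → P j p) → P k p) (x : M) : P x p := by
  obtain ⟨u, hu, hx⟩ := Z.trans_mem x
  exact Z.setind P hP p u (fun k hk ih => h k fun j hj => ih j hj (hu k hk j hj)) x hx

theorem russell (s : M) (h : ∀ t, e t s) : False := by
  have := Z.de
  obtain ⟨b, hb⟩ := Z.sep (fun t _ => ¬ e t t) (fun m i σ => by infer_instance) ![] s
  have := hb b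
  have := h b
  tauto

end ZG

/-- Rank comparison: `c` has rank at most that of `b`, witnessed by a set simulation. -/
def Le (e : M → M → Prop) (c b : M) : Prop :=
  ∃ r, FunVal e r c b ∧ ∀ a d, FunVal e r a d → ∀ a', e a' a → ∃ d', e d' d ∧ FunVal e r a' d'

instance dLe (e : M → M → Prop) [Df2 e1 e2 e] (i j : Fin n) :
    Df e1 e2 n (fun w => Le e (w i) (w j)) := by
  unfold Le; infer_instance

namespace ZG
variable {e : M → M → Prop} (Z : ZG e1 e2 e)
include Z

theorem le_iff (c b : M) : Le e c b ↔ ∀ c', e c' c → ∃ b', e b' b ∧ Le e c' b' := by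
  have := Z.de
  constructor
  · rintro ⟨r, h, hr⟩ c' hc'
    obtain ⟨b', hb', h'⟩ := hr c b h c' hc'
    exact ⟨b', hb', r, h', hr⟩
  · intro h
    obtain ⟨u, hu, hcu⟩ := Z.trans_mem c
    obtain ⟨v, hv, hbv⟩ := Z.trans_mem b
    obtain ⟨r, hr⟩ := Z.relgraph (fun t s w => Le e t s ∨ (t = w 0 ∧ s = w 1))
      (fun m i j σ => by infer_instance) ![c, b] u v
    have hr : ∀ t s, FunVal e r t s ↔ e t u ∧ e s v ∧ (Le e t s ∨ (t = c ∧ s = b)) := hr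
    refine ⟨r, (hr c b).2 ⟨hcu, hbv, Or.inr ⟨rfl, rfl⟩⟩, ?_⟩
    intro a d had a' ha'
    obtain ⟨h1, h2, h3⟩ := (hr a d).1 had
    have : ∃ d', e d' d ∧ Le e a' d' := by
      rcases h3 with ⟨q, hq, hq'⟩ | ⟨rfl, rfl⟩
      · obtain ⟨d', hd', h'⟩ := hq' a d hq a' ha'
        exact ⟨d', hd', q, h', hq'⟩
      · exact h a' ha'
    obtain ⟨d', hd', hl⟩ := this
    exact ⟨d', hd', (hr a' d').2 ⟨hu a h1 a' ha', hv d h2 d' hd', Or.inl hl⟩⟩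

theorem le_total (c : M) : ∀ b, Le e c b ∨ Le e b c := by
  have := Z.de
  refine Z.ind (fun c _ => ∀ b, Le e c b ∨ Le e b c) (fun m i σ => by infer_instance) ![] ?_ c
  intro c ih b
  show Le e c b ∨ Le e b c
  by_cases h : Le e c b
  · exact Or.inl h
  · right
    rw [Z.le_iff] at h
    push Not at h
    obtain ⟨c', hc', h⟩ := h
    rw [Z.le_iff]
    intro b' hb'
    exact ⟨c', hc', (ih c' hc' b').resolve_left (h b' hb')⟩

theorem T_union (a : M) (h : ∀ b, e b a → ∃ T, ∀ c, e c T ↔ Le e c b) :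
    ∃ U, ∀ c, e c U ↔ ∃ b, e b a ∧ Le e c b := by
  have := Z.de
  obtain ⟨I, hI⟩ := Z.img (fun b T _ => ∀ c, e c T ↔ Le e c b)
    (fun m i j σ => by infer_instance) ![] a
    (fun t _ s s' h h' => Z.ext _ _ fun c => by rw [h c, h' c])
  have hI : ∀ T, e T I ↔ ∃ b, e b a ∧ ∀ c, e c T ↔ Le e c b := hI
  obtain ⟨U, hU⟩ := Z.union I
  refine ⟨U, fun c => ?_⟩
  rw [hU]
  constructor
  · rintro ⟨T, hT, hc⟩
    obtain ⟨b, hb, hb'⟩ := (hI T).1 hT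
    exact ⟨b, hb, (hb' c).1 hc⟩
  · rintro ⟨b, hb, hc⟩
    obtain ⟨T, hT⟩ := h b hb
    exact ⟨T, (hI T).2 ⟨b, hb, hT⟩, (hT c).2 hc⟩

theorem T_ex (b : M) : ∃ T, ∀ c, e c T ↔ Le e c b := by
  have := Z.de
  refine Z.ind (fun b _ => ∃ T, ∀ c, e c T ↔ Le e c b) (fun m i σ => by infer_instance) ![] ?_ b
  intro b ih
  show ∃ T, ∀ c, e c T ↔ Le e c b
  obtain ⟨U, hU⟩ := Z.T_union b ih
  obtain ⟨T, hT⟩ := Z.power U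
  refine ⟨T, fun c => ?_⟩
  rw [hT, Z.le_iff]
  simp only [hU]

theorem T_union' (a : M) : ∃ U, ∀ c, e c U ↔ ∃ b, e b a ∧ Le e c b :=
  Z.T_union a fun b _ => Z.T_ex b

end ZG

/-- `B` is the greatest-fixpoint matching relation between `e` and `e'`. -/
def Mat (e e' B : M → M → Prop) : Prop :=
  ∀ x y, B x y ↔ (∀ a, e a x → ∃ b, e' b y ∧ B a b) ∧ (∀ b, e' b y → ∃ a, e a x ∧ B a b)

section matching
variable {e e' B : M → M → Prop}

theorem Mat.flip (h : Mat e e' B) : Mat e' e (fun x y => B y x) :=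
  fun x y => (h y x).trans and_comm

theorem Df2.flip (h : Df2 e1 e2 B) : Df2 e1 e2 (fun x y => B y x) :=
  ⟨fun n i j => h.out n j i⟩

theorem mat_func (Z : ZG e1 e2 e) (Z' : ZG e1 e2 e') (hd : Df2 e1 e2 B)
    (h1 : ∀ x y, B x y → ∀ a, e a x → ∃ b, e' b y ∧ B a b)
    (h2 : ∀ x y, B x y → ∀ b, e' b y → ∃ a, e a x ∧ B a b) (x : M) :
    ∀ y y', B x y → B x y' → y = y' := by
  refine Z.ind (fun x _ => ∀ y y', B x y → B x y' → y = y') (fun m i σ => by infer_instance) ![]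
    ?_ x
  intro x ih
  have ih : ∀ a, e a x → ∀ y y', B a y → B a y' → y = y' := ih
  have key : ∀ y y', B x y → B x y' → ∀ t, e' t y → e' t y' := by
    intro y y' h h' t ht
    obtain ⟨a, ha, hat⟩ := h2 x y h t ht
    obtain ⟨t', ht', hat'⟩ := h1 x y' h' a ha
    rwa [ih a ha _ _ hat hat']
  exact fun y y' h h' => Z'.ext _ _ fun t => ⟨key y y' h h' t, key y' y h' h t⟩

theorem mat_le (Z : ZG e1 e2 e) (Z' : ZG e1 e2 e') (hd : Df2 e1 e2 B) (h : Mat e e' B) (a : M) :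
    ∀ b, B a b → ∀ c, Le e c a → ∃ d, Le e' d b ∧ B c d := by
  have := Z.de
  have := Z'.de
  refine Z.ind (fun a _ => ∀ b, B a b → ∀ c, Le e c a → ∃ d, Le e' d b ∧ B c d)
    (fun m i σ => by infer_instance) ![] ?_ a
  intro a ih
  have ih : ∀ a', e a' a → ∀ b, B a' b → ∀ c, Le e c a' → ∃ d, Le e' d b ∧ B c d := ih
  show ∀ b, B a b → ∀ c, Le e c a → ∃ d, Le e' d b ∧ B c d
  intro b hab c hc
  obtain ⟨U, hU⟩ := Z'.T_union' b
  obtain ⟨d, hd'⟩ := Z'.sep (fun t w => ∃ c', e c' (w 0) ∧ B c' t)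
    (fun m i σ => by infer_instance) ![c] U
  have hd' : ∀ t, e' t d ↔ e' t U ∧ ∃ c', e c' c ∧ B c' t := hd'
  refine ⟨d, ?_, (h c d).2 ⟨?_, ?_⟩⟩
  · rw [Z'.le_iff]
    intro t ht
    exact (hU t).1 ((hd' t).1 ht).1
  · intro c' hc'
    obtain ⟨a', ha', hl⟩ := (Z.le_iff c a).1 hc c' hc'
    obtain ⟨b', hb', hab'⟩ := ((h a b).1 hab).1 a' ha'
    obtain ⟨d', hl', hcd⟩ := ih a' ha' b' hab' c' hl
    exact ⟨d', (hd' d').2 ⟨(hU d').2 ⟨b', hb', hl'⟩, c', hc', hcd⟩, hcd⟩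
  · intro t ht
    exact ((hd' t).1 ht).2

theorem mat_total (Z : ZG e1 e2 e) (Z' : ZG e1 e2 e') (hd : Df2 e1 e2 B) (h : Mat e e' B) (x : M) :
    ∃ y, B x y := by
  have := Z.de
  have := Z'.de
  have hfun := mat_func Z Z' hd (fun x y k => ((h x y).1 k).1) (fun x y k => ((h x y).1 k).2)
  refine Z.ind (fun x _ => ∃ y, B x y) (fun m i σ => by infer_instance) ![] ?_ x
  intro x ih
  have ih : ∀ a, e a x → ∃ y, B a y := ih
  show ∃ y, B x y
  by_contra hno
  have claim : ∀ c, ∃ a b, e a x ∧ B a b ∧ Le e' c b := by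
    intro c
    by_contra hc
    push Not at hc
    apply hno
    obtain ⟨T, hT⟩ := Z'.T_ex c
    obtain ⟨y, hy⟩ := Z'.sep (fun t w => ∃ a, e a (w 0) ∧ B a t)
      (fun m i σ => by infer_instance) ![x] T
    have hy : ∀ t, e' t y ↔ e' t T ∧ ∃ a, e a x ∧ B a t := hy
    refine ⟨y, (h x y).2 ⟨?_, fun t ht => ((hy t).1 ht).2⟩⟩
    intro a ha
    obtain ⟨b, hb⟩ := ih a ha
    refine ⟨b, (hy b).2 ⟨(hT b).2 ?_, a, ha, hb⟩, hb⟩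
    exact (Z'.le_total c b).resolve_left (hc a b ha hb)
  obtain ⟨U, hU⟩ := Z.T_union' x
  obtain ⟨S, hS⟩ := Z.img (fun t s _ => B t s) (fun m i j σ => by infer_instance) ![] U
    (fun t _ => hfun t)
  have hS : ∀ s, e s S ↔ ∃ t, e t U ∧ B t s := hS
  refine Z.russell S fun c => ?_
  obtain ⟨a, b, ha, hab, hl⟩ := claim c
  obtain ⟨d, hl', hB⟩ := mat_le Z' Z hd.flip h.flip b a hab c hl
  exact (hS c).2 ⟨d, (hU d).2 ⟨a, ha, hl'⟩, hB⟩

end matching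

/-- Bisimilarity, witnessed by an `e`-set of `e`-pairs. -/
def Bis (e e' : M → M → Prop) (x y : M) : Prop :=
  ∃ r, FunVal e r x y ∧ ∀ a b, FunVal e r a b →
    (∀ a', e a' a → ∃ b', e' b' b ∧ FunVal e r a' b') ∧
    (∀ b', e' b' b → ∃ a', e a' a ∧ FunVal e r a' b')

theorem dBis (e e' : M → M → Prop) [Df2 e1 e2 e] [Df2 e1 e2 e'] : Df2 e1 e2 (Bis e e') :=
  ⟨fun n i j => by unfold Bis; infer_instance⟩

theorem mat_bis {e e' : M → M → Prop} (Z : ZG e1 e2 e) (Z' : ZG e1 e2 e') :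
    Mat e e' (Bis e e') := by
  have := Z.de
  have := Z'.de
  have hd : Df2 e1 e2 (Bis e e') := dBis e e'
  have h1 : ∀ x y, Bis e e' x y → ∀ a, e a x → ∃ b, e' b y ∧ Bis e e' a b := by
    rintro x y ⟨r, hxy, hr⟩ a ha
    obtain ⟨b, hb, hab⟩ := (hr x y hxy).1 a ha
    exact ⟨b, hb, r, hab, hr⟩
  have h2 : ∀ x y, Bis e e' x y → ∀ b, e' b y → ∃ a, e a x ∧ Bis e e' a b := by
    rintro x y ⟨r, hxy, hr⟩ b hb
    obtain ⟨a, ha, hab⟩ := (hr x y hxy).2 b hb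
    exact ⟨a, ha, r, hab, hr⟩
  have hfun := mat_func Z Z' hd h1 h2
  intro x y
  refine ⟨fun h => ⟨h1 x y h, h2 x y h⟩, ?_⟩
  rintro ⟨k1, k2⟩
  by_cases hxs : ∃ s, Bis e e' x s
  · obtain ⟨s, hs⟩ := hxs
    have : s = y := by
      refine Z'.ext _ _ fun t => ⟨fun ht => ?_, fun ht => ?_⟩
      · obtain ⟨a, ha, hat⟩ := h2 x s hs t ht
        obtain ⟨t', ht', hat'⟩ := k1 a ha
        rwa [hfun a _ _ hat hat']
      · obtain ⟨a, ha, hat⟩ := k2 t ht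
        obtain ⟨t', ht', hat'⟩ := h1 x s hs a ha
        rwa [hfun a _ _ hat hat']
    exact this ▸ hs
  have hne : ∀ a b, Bis e e' a b → ¬ a = x := fun a b h h' => hxs ⟨b, h' ▸ h⟩
  obtain ⟨u, hu, hxu⟩ := Z.trans_mem x
  obtain ⟨r, -, hr⟩ := Z.graph
    (fun t s w => (t = w 0 ∧ s = w 1) ∨ (¬ t = w 0 ∧ Bis e e' t s))
    (fun m i j σ => by infer_instance) ![x, y] u (by
      intro t _ s s'
      show ((t = x ∧ s = y) ∨ (¬ t = x ∧ Bis e e' t s)) →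
        ((t = x ∧ s' = y) ∨ (¬ t = x ∧ Bis e e' t s')) → s = s'
      rintro (⟨h, rfl⟩ | ⟨h, k⟩) (⟨h', rfl⟩ | ⟨h', k'⟩)
      · rfl
      · exact absurd h h'
      · exact absurd h' h
      · exact hfun t _ _ k k')
  have hr : ∀ t s, FunVal e r t s ↔ e t u ∧ ((t = x ∧ s = y) ∨ (¬ t = x ∧ Bis e e' t s)) := hr
  refine ⟨r, (hr x y).2 ⟨hxu, Or.inl ⟨rfl, rfl⟩⟩, ?_⟩
  intro a b hab
  obtain ⟨hau, hab⟩ := (hr a b).1 hab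
  have hm : (∀ a', e a' a → ∃ b', e' b' b ∧ Bis e e' a' b') ∧
      (∀ b', e' b' b → ∃ a', e a' a ∧ Bis e e' a' b') := by
    rcases hab with ⟨rfl, rfl⟩ | ⟨-, h⟩
    · exact ⟨k1, k2⟩
    · exact ⟨h1 a b h, h2 a b h⟩
  constructor
  · intro a' ha'
    obtain ⟨b', hb', h⟩ := hm.1 a' ha'
    exact ⟨b', hb', (hr a' b').2 ⟨hu a hau a' ha', Or.inr ⟨hne _ _ h, h⟩⟩⟩
  · intro b' hb'
    obtain ⟨a', ha', h⟩ := hm.2 b' hb'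
    exact ⟨a', ha', (hr a' b').2 ⟨hu a hau a' ha', Or.inr ⟨hne _ _ h, h⟩⟩⟩

theorem final {e e' : M → M → Prop} (Z : ZG e1 e2 e) (Z' : ZG e1 e2 e') :
    ∃ F : e ≃r e', ∀ x y : M, Phi e e' x y ↔ F x = y := by
  have := Z.de
  have := Z'.de
  have hd : Df2 e1 e2 (Bis e e') := dBis e e'
  have hm := mat_bis Z Z'
  have hfun := mat_func Z Z' hd (fun x y k => ((hm x y).1 k).1) (fun x y k => ((hm x y).1 k).2)
  have hinj := mat_func Z' Z hd.flip (fun x y k => ((hm y x).1 k).2)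
    (fun x y k => ((hm y x).1 k).1)
  choose f hf using mat_total Z Z' hd hm
  choose g hg using mat_total Z' Z hd.flip hm.flip
  have hmem : ∀ a x, e' (f a) (f x) ↔ e a x := by
    intro a x
    constructor
    · intro h
      obtain ⟨a', ha', h'⟩ := ((hm _ _).1 (hf x)).2 _ h
      rwa [hinj _ _ _ (hf a) h']
    · intro h
      obtain ⟨b, hb, h'⟩ := ((hm _ _).1 (hf x)).1 _ h
      rwa [hfun _ _ _ (hf a) h']
  let F : e ≃r e' :=
    { toFun := f
      invFun := g
      left_inv := fun x => hinj _ _ _ (hg (f x)) (hf x)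
      right_inv := fun y => hfun _ _ _ (hf (g y)) (hg y)
      map_rel_iff' := fun {a b} => hmem a b }
  have hF : ∀ x, F x = f x := fun _ => rfl
  refine ⟨F, fun x y => ?_⟩
  rw [hF]
  constructor
  · rintro ⟨q, sx, tcsx, tcx, tcy, hsx, ⟨hT1, hT2, hT3⟩, ⟨hX1, hX2, hX3⟩, ⟨hY1, hY2, hY3⟩,
      ⟨hq1, hq2, hq3⟩, hii, hiii, hiv, hv⟩
    refine hfun x _ _ (hf x) ⟨q, hv, ?_⟩
    -- elements of `tcsx` are `x` or in `tcx`
    have hxt : e x tcsx := hT2 x ((hsx x).2 rfl)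
    have hsub : ∀ t, e t tcx → e t tcsx :=
      hX3 tcsx hT1 fun w hw => hT1 x hxt w hw
    have hcase : ∀ t, e t tcsx → t = x ∨ e t tcx := by
      obtain ⟨c, hc⟩ := Z.cup sx tcx
      intro t ht
      have := hT3 c ?_ (fun w hw => (hc w).2 (Or.inl hw)) t ht
      · rcases (hc t).1 this with h | h
        · exact Or.inl ((hsx t).1 h)
        · exact Or.inr h
      · intro t ht w hw
        refine (hc w).2 (Or.inr ?_)
        rcases (hc t).1 ht with h | h
        · obtain rfl := (hsx t).1 h
          exact hX2 w hw
        · exact hX1 t h w hw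
    intro a b hab
    have ha : e a tcsx := by
      obtain ⟨p, hp, hp'⟩ := hab
      obtain ⟨a', b', ha', h'⟩ := hq1 p hp
      rwa [(Z.opair_inj hp' h').1]
    have hel : ∀ a', e a' a → e a' tcx := by
      intro a' ha'
      rcases hcase a ha with rfl | h
      · exact hX2 a' ha'
      · exact hX1 a h a' ha'
    constructor
    · intro a' ha'
      obtain ⟨b', hb'⟩ := hq2 a' (hsub a' (hel a' ha'))
      exact ⟨b', (hiv a' (hel a' ha') a ha b' b hb' hab).1 ha', hb'⟩
    · intro b' hb'
      have : e' b' tcy := by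
        rcases hcase a ha with rfl | h
        · rw [hq3 _ _ _ hab hv] at hb'
          exact hY2 b' hb'
        · exact hY1 b (hii a h b hab) b' hb'
      obtain ⟨a', ha', hab'⟩ := hiii b' this
      exact ⟨a', (hiv a' ha' a ha b' b hab' hab).2 hb', hab'⟩
  · rintro rfl
    obtain ⟨sx, hsx⟩ := Z.sing x
    obtain ⟨tcsx, hT⟩ := Z.tc_ex sx
    obtain ⟨tcx, hX⟩ := Z.tc_ex x
    obtain ⟨q, hq1, hq⟩ := Z.graph (fun t s _ => Bis e e' t s) (fun m i j σ => by infer_instance)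
      ![] tcsx (fun t _ => hfun t)
    have hq : ∀ t s, FunVal e q t s ↔ e t tcsx ∧ f t = s := by
      intro t s
      rw [hq]
      exact and_congr_right fun _ =>
        ⟨fun h => hfun _ _ _ (hf t) h, fun h => h ▸ hf t⟩
    have hxt : e x tcsx := hT.2.1 x ((hsx x).2 rfl)
    have hsub : ∀ t, e t tcx → e t tcsx :=
      hX.2.2 tcsx hT.1 fun w hw => hT.1 x hxt w hw
    have hfs : ∀ y, f (g y) = y := F.right_inv
    have hmem' : ∀ b x, e' b (f x) ↔ e (g b) x := fun b x => by
      rw [← hmem, hfs]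
    have hmem2 : ∀ a y, e a (g y) ↔ e' (f a) y := fun a y => by
      rw [← hmem, hfs]
    refine ⟨q, sx, tcsx, tcx, f tcx, hsx, hT, hX, ⟨?_, ?_, ?_⟩, ⟨?_, ?_, ?_⟩, ?_, ?_, ?_, ?_⟩
    · intro t ht w hw
      rw [hmem'] at ht ⊢
      exact hX.1 _ ht _ ((hmem' _ _).1 (by rwa [hfs]))
    · intro v hv
      rw [hmem'] at hv ⊢
      exact hX.2.1 _ hv
    · intro v hv hxv w hw
      rw [hmem'] at hw
      have := hX.2.2 (g v) ?_ ?_ _ hw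
      · rwa [hmem2, hfs] at this
      · intro t ht r hr
        rw [hmem2] at ht ⊢
        exact hv _ ht _ ((hmem _ _).2 hr)
      · intro r hr
        rw [hmem2]
        exact hxv _ ((hmem _ _).2 hr)
    · exact hq1
    · intro a ha
      exact ⟨f a, (hq _ _).2 ⟨ha, rfl⟩⟩
    · intro a b b' h h'
      rw [← ((hq _ _).1 h).2, ← ((hq _ _).1 h').2]
    · intro t ht ft h
      rw [← ((hq _ _).1 h).2, hmem]
      exact ht
    · intro t ht
      rw [hmem'] at ht
      exact ⟨g t, ht, (hq _ _).2 ⟨hsub _ ht, hfs t⟩⟩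
    · intro t ht w hw ft fw h h'
      rw [← ((hq _ _).1 h).2, ← ((hq _ _).1 h').2, hmem]
    · exact (hq _ _).2 ⟨hxt, rfl⟩

end Zer

/-- **An extension of a theorem of Zermelo (Väänänen).**
If `(M, ∈₁, ∈₂)` is a model of `ZFC(∈₁) ∪ ZFC(∈₂)`, then the reduct
`(M, ∈₁)` is isomorphic to the reduct `(M, ∈₂)` as `{∈}`-structures, and
moreover the isomorphism is the class function defined in `(M, ∈₁, ∈₂)` by
the `L`-formula `φ(x, y)`. -/
theorem zermelo_extension {M : Type u} (Z : ZFC2Model M) :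
    ∃ F : Z.mem1 ≃r Z.mem2, ∀ x y : M, Phi Z.mem1 Z.mem2 x y ↔ F x = y := by
  exact final (e1 := Z.mem1) (e2 := Z.mem2)
    ⟨Df2.m1, Z.ext1, Z.found1, Z.pair1, Z.union1, Z.power1, Z.infinity1, Z.sep1, Z.repl1⟩
    ⟨Df2.m2, Z.ext2, Z.found2, Z.pair2, Z.union2, Z.power2, Z.infinity2, Z.sep2, Z.repl2⟩
end

section
/- Let M be a model of ZFC(∈₁) ∪ ZFC(∈₂). For all elements x, y, f, f' of M: if ψ(x,y,f) and ψ(x,y,f') hold in M, then f = f'. -/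
universe u

namespace PsiAux

def neg (a : Fml) : Fml := .imp a .fal
def conj (a b : Fml) : Fml := neg (.imp a (neg b))
def disj (a b : Fml) : Fml := .imp (neg a) b
def bic (a b : Fml) : Fml := conj (.imp a b) (.imp b a)
def ex (n : ℕ) (a : Fml) : Fml := neg (.all n (neg a))

section
variable {M : Type u} (e₁ e₂ : M → M → Prop) (v : ℕ → M)

theorem sat_neg (a : Fml) : (neg a).Sat e₁ e₂ v ↔ ¬ a.Sat e₁ e₂ v := Iff.rfl
theorem sat_conj (a b : Fml) :
    (conj a b).Sat e₁ e₂ v ↔ (a.Sat e₁ e₂ v ∧ b.Sat e₁ e₂ v) := by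
  simp only [conj, neg, Fml.Sat]; tauto
theorem sat_disj (a b : Fml) :
    (disj a b).Sat e₁ e₂ v ↔ (a.Sat e₁ e₂ v ∨ b.Sat e₁ e₂ v) := by
  simp only [disj, neg, Fml.Sat]; tauto
theorem sat_bic (a b : Fml) :
    (bic a b).Sat e₁ e₂ v ↔ (a.Sat e₁ e₂ v ↔ b.Sat e₁ e₂ v) := by
  simp only [bic, sat_conj, Fml.Sat]; tauto
theorem sat_ex (n : ℕ) (a : Fml) :
    (ex n a).Sat e₁ e₂ v ↔ ∃ m, a.Sat e₁ e₂ (Function.update v n m) := by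
  simp only [ex, neg, Fml.Sat, ← not_forall_not]; rfl
end

/-- `FunVal` of variable `i` at variables `0`, `3`. -/
def fv (i : ℕ) : Fml :=
  ex 4 (conj (.mem1 4 i) (ex 5 (ex 6 (conj
    (.all 7 (bic (.mem1 7 5) (.eq 7 0)))
    (conj (.all 7 (bic (.mem1 7 6) (disj (.eq 7 0) (.eq 7 3))))
      (.all 7 (bic (.mem1 7 4) (disj (.eq 7 5) (.eq 7 6)))))))))

/-- The two functions in variables `1`, `2` disagree at variable `0`. -/
def disagree : Fml := neg (ex 3 (conj (fv 1) (fv 2)))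

theorem sat_disagree {M : Type u} (e₁ e₂ : M → M → Prop) (f f' t : M) (v : ℕ → M)
    (h1 : v 1 = f) (h2 : v 2 = f') :
    disagree.Sat e₁ e₂ (Function.update v 0 t) ↔
      ¬ ∃ b, FunVal e₁ f t b ∧ FunVal e₁ f' t b := by
  simp [disagree, fv, sat_neg, sat_conj, sat_disj, sat_bic, sat_ex, Fml.Sat,
    Function.update_apply, h1, h2, FunVal, IsOPair, IsSingleton]

theorem tc_unique {M : Type u} {e : M → M → Prop} (he : Extensionality e) {x u v : M}
    (hu : IsTC e x u) (hv : IsTC e x v) : u = v :=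
  he _ _ fun t => ⟨hu.2.2 v hv.1 hv.2.1 t, hv.2.2 u hu.1 hu.2.1 t⟩

theorem opair_unique {M : Type u} {e : M → M → Prop} (he : Extensionality e) {a b p q : M}
    (hp : IsOPair e a b p) (hq : IsOPair e a b q) : p = q := by
  obtain ⟨s, r, h1, h2, h3⟩ := hp
  obtain ⟨s', r', h1', h2', h3'⟩ := hq
  have hs : s = s' := he _ _ fun t => (h1 t).trans (h1' t).symm
  have hr : r = r' := he _ _ fun t => (h2 t).trans (h2' t).symm
  subst hs hr
  exact he _ _ fun t => (h3 t).trans (h3' t).symm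

theorem func_sub {M : Type u} {e : M → M → Prop} (he : Extensionality e) {f f' d : M}
    (hf : IsFuncOn e f d)
    (H : ∀ a, e a d → ∃ b, FunVal e f a b ∧ FunVal e f' a b) (p : M) (hp : e p f) :
    e p f' := by
  obtain ⟨a, b, ha, hab⟩ := hf.1 p hp
  obtain ⟨c, hc, q, hq, hq'⟩ := H a ha
  obtain rfl := hf.2.2 a b c ⟨p, hp, hab⟩ hc
  rwa [opair_unique he hab hq']

end PsiAux

/-- If `ψ(x, y, f)` and `ψ(x, y, f')` hold in a model of
`ZFC(∈₁) ∪ ZFC(∈₂)`, then `f = f'`. -/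
theorem psi_functional_in_f {M : Type u} (Z : ZFC2Model M) (x y f f' : M)
    (h : Psi Z.mem1 Z.mem2 x y f) (h' : Psi Z.mem1 Z.mem2 x y f') :
    f = f' := by
  obtain ⟨sx, tcsx, tcx, tcy, hsx, htcsx, htcx, htcy, hf, hf2, hf3, hf4, hf5⟩ := h
  obtain ⟨sx', tcsx', tcx', tcy', hsx', htcsx', htcx', htcy', hg, hg2, hg3, hg4, hg5⟩ := h'
  obtain rfl : sx = sx' := Z.ext1 _ _ fun t => (hsx t).trans (hsx' t).symm
  obtain rfl := PsiAux.tc_unique Z.ext1 htcsx htcsx'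
  obtain rfl := PsiAux.tc_unique Z.ext1 htcx htcx'
  obtain rfl := PsiAux.tc_unique Z.ext2 htcy htcy'
  have hx : Z.mem1 x tcsx := htcsx.2.1 x ((hsx x).2 rfl)
  have hsub : ∀ t, Z.mem1 t tcx → Z.mem1 t tcsx :=
    htcx.2.2 tcsx htcsx.1 fun w hw => htcsx.1 x hx w hw
  -- every element of `TC({x})` is `x` or lies in `TC(x)`
  have hcase : ∀ t, Z.mem1 t tcsx → Z.mem1 t tcx ∨ t = x := by
    obtain ⟨q, hq⟩ := Z.pair1 tcx sx
    obtain ⟨r, hr⟩ := Z.union1 q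
    have hr' : ∀ t, Z.mem1 t r ↔ (Z.mem1 t tcx ∨ t = x) := by
      intro t
      rw [hr, ← hsx t]
      simp [hq]
    intro t ht
    rw [← hr']
    refine htcsx.2.2 r ?_ ?_ t ht
    · intro a ha w hw
      rw [hr'] at ha ⊢
      rcases ha with ha | rfl
      · exact Or.inl (htcx.1 a ha w hw)
      · exact Or.inl (htcx.2.1 w hw)
    · intro w hw
      exact (hr' w).2 (Or.inr ((hsx w).1 hw))
  have key : ∀ t, Z.mem1 t tcx → ∃ b, FunVal Z.mem1 f t b ∧ FunVal Z.mem1 f' t b := by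
    by_contra! hcon
    obtain ⟨t0, ht0, hbad⟩ := hcon
    obtain ⟨D, hD⟩ := Z.sep1 PsiAux.disagree (fun n => if n = 1 then f else f') tcx
    have hD' : ∀ t, Z.mem1 t D ↔
        (Z.mem1 t tcx ∧ ¬ ∃ b, FunVal Z.mem1 f t b ∧ FunVal Z.mem1 f' t b) := by
      intro t
      rw [hD, PsiAux.sat_disagree Z.mem1 Z.mem2 f f' t _ (by simp) (by simp)]
    obtain ⟨t, htD, hmin⟩ := Z.found1 D ⟨t0, (hD' t0).2 ⟨ht0, by
      rintro ⟨b, h1, h2⟩; exact hbad b h1 h2⟩⟩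
    obtain ⟨ht, hne⟩ := (hD' t).1 htD
    have hagree : ∀ s, Z.mem1 s t → ∃ b, FunVal Z.mem1 f s b ∧ FunVal Z.mem1 f' s b := by
      intro s hs
      by_contra hc
      exact hmin s hs ((hD' s).2 ⟨htcx.1 t ht s hs, hc⟩)
    obtain ⟨b, hb⟩ := hf.2.1 t (hsub t ht)
    obtain ⟨c, hc⟩ := hg.2.1 t (hsub t ht)
    have hbc : b = c := by
      refine Z.ext2 _ _ fun u => ⟨fun hu => ?_, fun hu => ?_⟩
      · obtain ⟨s, hs, hsu⟩ := hf3 u (htcy.1 b (hf2 t ht b hb) u hu)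
        have hst := (hf4 s hs t (hsub t ht) u b hsu hb).2 hu
        obtain ⟨d, hd, hd'⟩ := hagree s hst
        obtain rfl := hf.2.2 s u d hsu hd
        exact (hg4 s hs t (hsub t ht) u c hd' hc).1 hst
      · obtain ⟨s, hs, hsu⟩ := hg3 u (htcy.1 c (hg2 t ht c hc) u hu)
        have hst := (hg4 s hs t (hsub t ht) u c hsu hc).2 hu
        obtain ⟨d, hd, hd'⟩ := hagree s hst
        obtain rfl := hg.2.2 s u d hsu hd'
        exact (hf4 s hs t (hsub t ht) u b hd hb).1 hst
    exact hne ⟨b, hb, hbc ▸ hc⟩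
  have H : ∀ a, Z.mem1 a tcsx → ∃ b, FunVal Z.mem1 f a b ∧ FunVal Z.mem1 f' a b := by
    intro a ha
    rcases hcase a ha with h | rfl
    · exact key a h
    · exact ⟨y, hf5, hg5⟩
  exact Z.ext1 _ _ fun p => ⟨PsiAux.func_sub Z.ext1 hf H p,
    PsiAux.func_sub Z.ext1 hg (fun a ha => (H a ha).imp fun _ h => h.symm) p⟩
end

section
/- Let M be a model of ZFC(∈₁) ∪ ZFC(∈₂). Suppose ψ(x,y,f) holds in M. Then: (a) for every x' with x' ∈₁ x, φ(x', f(x')) holds in M; and (b) for every y' with y' ∈₂ y, there exists x' with x' ∈₁ x such that f(x') = y' and φ(x', y') holds in M. -/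
universe u

namespace Fml

def neg (φ : Fml) : Fml := .imp φ .fal
def conj (φ ψ : Fml) : Fml := neg (.imp φ (neg ψ))
def disj (φ ψ : Fml) : Fml := .imp (neg φ) ψ
def bic (φ ψ : Fml) : Fml := conj (.imp φ ψ) (.imp ψ φ)
def ex (n : ℕ) (φ : Fml) : Fml := neg (.all n (neg φ))

variable {M : Type u} (e₁ e₂ : M → M → Prop)

theorem sat_neg (φ : Fml) (v : ℕ → M) : (neg φ).Sat e₁ e₂ v ↔ ¬ φ.Sat e₁ e₂ v := Iff.rfl

theorem sat_conj (φ ψ : Fml) (v : ℕ → M) :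
    (conj φ ψ).Sat e₁ e₂ v ↔ (φ.Sat e₁ e₂ v ∧ ψ.Sat e₁ e₂ v) := by
  simp only [conj, sat_neg, Sat]; tauto

theorem sat_disj (φ ψ : Fml) (v : ℕ → M) :
    (disj φ ψ).Sat e₁ e₂ v ↔ (φ.Sat e₁ e₂ v ∨ ψ.Sat e₁ e₂ v) := by
  simp only [disj, sat_neg, Sat]; tauto

theorem sat_bic (φ ψ : Fml) (v : ℕ → M) :
    (bic φ ψ).Sat e₁ e₂ v ↔ (φ.Sat e₁ e₂ v ↔ ψ.Sat e₁ e₂ v) := by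
  simp only [bic, sat_conj, Sat]; tauto

theorem sat_ex (n : ℕ) (φ : Fml) (v : ℕ → M) :
    (ex n φ).Sat e₁ e₂ v ↔ ∃ a, φ.Sat e₁ e₂ (Function.update v n a) := by
  simp only [ex, sat_neg, Sat, not_forall, not_not]

/-- `FunVal` for `∈₁`, as a formula; bound variables are 10, ..., 13. -/
def fv (i j k : ℕ) : Fml :=
  ex 10 (conj (.mem1 10 i) (ex 11 (ex 12 (conj (.all 13 (bic (.mem1 13 11) (.eq 13 j)))
    (conj (.all 13 (bic (.mem1 13 12) (disj (.eq 13 j) (.eq 13 k))))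
      (.all 13 (bic (.mem1 13 10) (disj (.eq 13 11) (.eq 13 12)))))))))

theorem sat_fv (i j k : ℕ) (hi : i < 10) (hj : j < 10) (hk : k < 10) (v : ℕ → M) :
    (fv i j k).Sat e₁ e₂ v ↔ FunVal e₁ (v i) (v j) (v k) := by
  have a1 : i ≠ 10 := by omega
  have b1 : j ≠ 10 := by omega
  have b2 : j ≠ 11 := by omega
  have b3 : j ≠ 12 := by omega
  have b4 : j ≠ 13 := by omega
  have c1 : k ≠ 10 := by omega
  have c2 : k ≠ 11 := by omega
  have c3 : k ≠ 12 := by omega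
  have c4 : k ≠ 13 := by omega
  simp [fv, sat_ex, sat_conj, sat_bic, sat_disj, Sat, FunVal, IsOPair, IsSingleton,
    Function.update_apply, *]

end Fml

/-- A subset of a transitive set has a transitive closure (for `e = ∈₁` or `∈₂`). -/
theorem exists_tc {M : Type u} (e : M → M → Prop)
    (sep : ∀ x a : M, ∃ b, ∀ t, e t b ↔ (e t a ∧ ∀ v, IsTransSet e v →
      (∀ w, e w x → e w v) → e t v))
    (x u : M) (hu : IsTransSet e u) (hx : ∀ w, e w x → e w u) :
    ∃ c, IsTC e x c := by
  obtain ⟨c, hc⟩ := sep x u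
  refine ⟨c, ?_, ?_, ?_⟩
  · intro t ht w hw
    rw [hc] at ht ⊢
    exact ⟨hu t ht.1 w hw, fun v hv hxv => hv t (ht.2 v hv hxv) w hw⟩
  · intro v hv
    rw [hc]
    exact ⟨hx v hv, fun v' _ h => h v hv⟩
  · intro v hv hxv w hw
    exact ((hc w).1 hw).2 v hv hxv

theorem ZFC2Model.exists_tc1 {M : Type u} (Z : ZFC2Model M)
    (x u : M) (hu : IsTransSet Z.mem1 u) (hx : ∀ w, Z.mem1 w x → Z.mem1 w u) :
    ∃ c, IsTC Z.mem1 x c := by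
  refine exists_tc _ (fun x a => ?_) x u hu hx
  obtain ⟨b, hb⟩ := Z.sep1 (.all 2 (.imp
    (.all 3 (.imp (.mem1 3 2) (.all 4 (.imp (.mem1 4 3) (.mem1 4 2)))))
    (.imp (.all 3 (.imp (.mem1 3 1) (.mem1 3 2))) (.mem1 0 2)))) (fun _ => x) a
  refine ⟨b, fun t => (hb t).trans ?_⟩
  simp [Fml.Sat, Function.update_apply, IsTransSet]

theorem ZFC2Model.exists_tc2 {M : Type u} (Z : ZFC2Model M)
    (x u : M) (hu : IsTransSet Z.mem2 u) (hx : ∀ w, Z.mem2 w x → Z.mem2 w u) :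
    ∃ c, IsTC Z.mem2 x c := by
  refine exists_tc _ (fun x a => ?_) x u hu hx
  obtain ⟨b, hb⟩ := Z.sep2 (.all 2 (.imp
    (.all 3 (.imp (.mem2 3 2) (.all 4 (.imp (.mem2 4 3) (.mem2 4 2)))))
    (.imp (.all 3 (.imp (.mem2 3 1) (.mem2 3 2))) (.mem2 0 2)))) (fun _ => x) a
  refine ⟨b, fun t => (hb t).trans ?_⟩
  simp [Fml.Sat, Function.update_apply, IsTransSet]

/-- Restriction of a function to a set. -/
theorem ZFC2Model.exists_restrict {M : Type u} (Z : ZFC2Model M) (f d d' : M)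
    (hf : IsFuncOn Z.mem1 f d) (hd : ∀ t, Z.mem1 t d' → Z.mem1 t d) :
    ∃ g, IsFuncOn Z.mem1 g d' ∧
      ∀ a b, FunVal Z.mem1 g a b ↔ (FunVal Z.mem1 f a b ∧ Z.mem1 a d') := by
  obtain ⟨g, hg⟩ := Z.sep1 (.ex 2 (.conj (.mem1 2 1)
    (.all 3 (.imp (.mem1 3 0) (.mem1 2 3))))) (fun _ => d') f
  replace hg : ∀ p, Z.mem1 p g ↔
      (Z.mem1 p f ∧ ∃ a, Z.mem1 a d' ∧ ∀ s, Z.mem1 s p → Z.mem1 a s) := by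
    intro p
    refine (hg p).trans ?_
    simp [Fml.Sat, Fml.sat_ex, Fml.sat_conj, Function.update_apply]
  have key : ∀ a b p, IsOPair Z.mem1 a b p →
      ((∃ a, Z.mem1 a d' ∧ ∀ s, Z.mem1 s p → Z.mem1 a s) ↔ Z.mem1 a d') := by
    rintro a b p ⟨sa, pab, h1, h2, h3⟩
    constructor
    · rintro ⟨c, hc, hcs⟩
      have := (h1 c).1 (hcs sa ((h3 sa).2 (Or.inl rfl)))
      exact this ▸ hc
    · intro ha
      refine ⟨a, ha, fun s hs => ?_⟩
      rcases (h3 s).1 hs with rfl | rfl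
      · exact (h1 a).2 rfl
      · exact (h2 a).2 (Or.inl rfl)
  have hval : ∀ a b, FunVal Z.mem1 g a b ↔ (FunVal Z.mem1 f a b ∧ Z.mem1 a d') := by
    intro a b
    constructor
    · rintro ⟨p, hp, ho⟩
      have := (hg p).1 hp
      exact ⟨⟨p, this.1, ho⟩, (key a b p ho).1 this.2⟩
    · rintro ⟨⟨p, hp, ho⟩, ha⟩
      exact ⟨p, (hg p).2 ⟨hp, (key a b p ho).2 ha⟩, ho⟩
  refine ⟨g, ⟨?_, ?_, ?_⟩, hval⟩
  · intro p hp
    have h := (hg p).1 hp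
    obtain ⟨a, b, _, ho⟩ := hf.1 p h.1
    exact ⟨a, b, (key a b p ho).1 h.2, ho⟩
  · intro a ha
    obtain ⟨b, hb⟩ := hf.2.1 a (hd a ha)
    exact ⟨b, (hval a b).2 ⟨hb, ha⟩⟩
  · intro a b c hb hc
    exact hf.2.2 a b c ((hval a b).1 hb).1 ((hval a c).1 hc).1

/-- Suppose `ψ(x, y, f)` holds in a model of `ZFC(∈₁) ∪ ZFC(∈₂)`. Then:
(a) for every `x' ∈₁ x` we have `φ(x', f(x'))`; and (b) for every
`y' ∈₂ y` there is `x' ∈₁ x` with `f(x') = y'` and `φ(x', y')`. -/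
theorem psi_restricts {M : Type u} (Z : ZFC2Model M) (x y f : M)
    (h : Psi Z.mem1 Z.mem2 x y f) :
    (∀ x', Z.mem1 x' x →
      ∃ fx', FunVal Z.mem1 f x' fx' ∧ Phi Z.mem1 Z.mem2 x' fx') ∧
    (∀ y', Z.mem2 y' y →
      ∃ x', Z.mem1 x' x ∧ FunVal Z.mem1 f x' y' ∧ Phi Z.mem1 Z.mem2 x' y') := by
  obtain ⟨sx, tcsx, tcx, tcy, hsx, htcsx, htcx, htcy, hf, h2, h3, h4, h5⟩ := h
  have hxs : Z.mem1 x tcsx := htcsx.2.1 x ((hsx x).2 rfl)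
  have hsub : ∀ w, Z.mem1 w tcx → Z.mem1 w tcsx :=
    htcx.2.2 tcsx htcsx.1 (htcsx.1 x hxs)
  have main : ∀ x', Z.mem1 x' x → ∀ b, FunVal Z.mem1 f x' b → Phi Z.mem1 Z.mem2 x' b := by
    intro x' hx' b hb
    have hxt2 : Z.mem1 x' tcx := htcx.2.1 x' hx'
    have hbt : Z.mem2 b tcy := h2 x' hxt2 b hb
    obtain ⟨s', hs'⟩ := Z.pair1 x' x'
    have hs'' : IsSingleton Z.mem1 x' s' := fun t => (hs' t).trans (or_self_iff)
    have hssub : ∀ w, Z.mem1 w s' → Z.mem1 w tcx := fun w hw => ((hs'' w).1 hw) ▸ hxt2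
    obtain ⟨tcs', htcs'⟩ := Z.exists_tc1 s' tcx htcx.1 hssub
    obtain ⟨tcx', htcx'⟩ := Z.exists_tc1 x' tcx htcx.1 (htcx.1 x' hxt2)
    obtain ⟨tcb, htcb⟩ := Z.exists_tc2 b tcy htcy.1 (htcy.1 b hbt)
    have hs1 : ∀ w, Z.mem1 w tcs' → Z.mem1 w tcx := htcs'.2.2 tcx htcx.1 hssub
    have hs2 : ∀ w, Z.mem1 w tcx' → Z.mem1 w tcx := htcx'.2.2 tcx htcx.1 (htcx.1 x' hxt2)
    have hs3 : ∀ w, Z.mem2 w tcb → Z.mem2 w tcy := htcb.2.2 tcy htcy.1 (htcy.1 b hbt)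
    obtain ⟨g, hg, hgv⟩ := Z.exists_restrict f tcsx tcs' hf (fun t ht => hsub t (hs1 t ht))
    have hxs2 : Z.mem1 x' tcs' := htcs'.2.1 x' ((hs'' x').2 rfl)
    have hs4 : ∀ w, Z.mem1 w tcx' → Z.mem1 w tcs' :=
      htcx'.2.2 tcs' htcs'.1 (htcs'.1 x' hxs2)
    refine ⟨g, s', tcs', tcx', tcb, hs'', htcs', htcx', htcb, hg, ?_, ?_, ?_, ?_⟩
    · -- into
      obtain ⟨S, hS⟩ := Z.sep1 (.ex 3 (.conj (.fv 1 0 3) (.mem2 3 2)))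
        (fun n => if n = 2 then tcb else f) tcx'
      replace hS : ∀ t, Z.mem1 t S ↔
          (Z.mem1 t tcx' ∧ ∃ ft, FunVal Z.mem1 f t ft ∧ Z.mem2 ft tcb) := by
        intro t
        refine (hS t).trans ?_
        simp [Fml.Sat, Fml.sat_ex, Fml.sat_conj, Fml.sat_fv, Function.update_apply]
      have step : ∀ t ft, Z.mem1 t tcx → FunVal Z.mem1 f t ft →
          (∀ s, Z.mem2 s ft → Z.mem2 s tcb) → ∀ w, Z.mem1 w t → Z.mem1 w tcx' →
          Z.mem1 w S := by
        intro t ft ht hft hs w hw hwt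
        obtain ⟨fw, hfw⟩ := hf.2.1 w (hsub w (hs2 w hwt))
        exact (hS w).2 ⟨hwt, fw, hfw,
          hs fw ((h4 w (hs2 w hwt) t (hsub t ht) fw ft hfw hft).1 hw)⟩
      have hall : ∀ w, Z.mem1 w tcx' → Z.mem1 w S := by
        apply htcx'.2.2 S
        · intro t ht w hw
          obtain ⟨htt, ft, hft, hfb⟩ := (hS t).1 ht
          exact step t ft (hs2 t htt) hft (htcb.1 ft hfb) w hw (htcx'.1 t htt w hw)
        · intro w hw
          exact step x' b hxt2 hb htcb.2.1 w hw (htcx'.2.1 w hw)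
      intro t ht ft hft
      obtain ⟨_, ft', hft', hm⟩ := (hS t).1 (hall t ht)
      rw [hf.2.2 t ft ft' ((hgv t ft).1 hft).1 hft']
      exact hm
    · -- onto
      obtain ⟨S, hS⟩ := Z.sep2 (.ex 3 (.conj (.mem1 3 2) (.fv 1 3 0)))
        (fun n => if n = 2 then tcx' else f) tcb
      replace hS : ∀ t, Z.mem2 t S ↔
          (Z.mem2 t tcb ∧ ∃ w, Z.mem1 w tcx' ∧ FunVal Z.mem1 f w t) := by
        intro t
        refine (hS t).trans ?_
        simp [Fml.Sat, Fml.sat_ex, Fml.sat_conj, Fml.sat_fv, Function.update_apply]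
      have step : ∀ w t, Z.mem1 w tcx → FunVal Z.mem1 f w t →
          (∀ s, Z.mem1 s w → Z.mem1 s tcx') → ∀ s, Z.mem2 s t → Z.mem2 s tcb →
          Z.mem2 s S := by
        intro w t hw hwt hsw s hs hsb
        obtain ⟨u, hu, hus⟩ := h3 s (hs3 s hsb)
        exact (hS s).2 ⟨hsb, u, hsw u ((h4 u hu w (hsub w hw) s t hus hwt).2 hs), hus⟩
      have hall : ∀ w, Z.mem2 w tcb → Z.mem2 w S := by
        apply htcb.2.2 S
        · intro t ht s hs
          obtain ⟨htb, w, hw, hwt⟩ := (hS t).1 ht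
          exact step w t (hs2 w hw) hwt (htcx'.1 w hw) s hs (htcb.1 t htb s hs)
        · intro s hs
          exact step x' b hxt2 hb htcx'.2.1 s hs (htcb.2.1 s hs)
      intro t ht
      obtain ⟨_, w, hw, hwt⟩ := (hS t).1 (hall t ht)
      exact ⟨w, hw, (hgv w t).2 ⟨hwt, hs4 w hw⟩⟩
    · intro t ht w hw ft fw hft hfw
      exact h4 t (hs2 t ht) w (hsub w (hs1 w hw)) ft fw ((hgv _ _).1 hft).1 ((hgv _ _).1 hfw).1
    · exact (hgv x' b).2 ⟨hb, hxs2⟩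
  constructor
  · intro x' hx'
    obtain ⟨b, hb⟩ := hf.2.1 x' (hsub x' (htcx.2.1 x' hx'))
    exact ⟨b, hb, main x' hx' b hb⟩
  · intro y' hy'
    obtain ⟨u, hu, huy⟩ := h3 y' (htcy.2.1 y' hy')
    have hux : Z.mem1 u x := (h4 u hu x hxs y' y huy h5).2 hy'
    exact ⟨u, hux, huy, main u hux y' huy⟩
end

section
/- Let M be a model of ZFC(∈₁) ∪ ZFC(∈₂). For all elements x, x', y, y' of M: (a) if φ(x,y) and φ(x,y') hold in M, then y = y'; and (b) if φ(x,y) and φ(x',y) hold in M, then x = x'. That is, the class relation defined by φ in M is both functional and injective. -/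
universe u

namespace PhiAux

def nt (p : Fml) : Fml := .imp p .fal
def an (p q : Fml) : Fml := nt (.imp p (nt q))
def orr (p q : Fml) : Fml := .imp (nt p) q
def iffF (p q : Fml) : Fml := an (.imp p q) (.imp q p)
def ex (n : ℕ) (p : Fml) : Fml := nt (.all n (nt p))

section
variable {M : Type u} (e₁ e₂ : M → M → Prop)

theorem sat_nt (p v) : (nt p).Sat e₁ e₂ v ↔ ¬ p.Sat e₁ e₂ v := Iff.rfl
theorem sat_an (p q v) : (an p q).Sat e₁ e₂ v ↔ (p.Sat e₁ e₂ v ∧ q.Sat e₁ e₂ v) := by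
  simp only [an, sat_nt, Fml.Sat]; tauto
theorem sat_orr (p q v) : (orr p q).Sat e₁ e₂ v ↔ (p.Sat e₁ e₂ v ∨ q.Sat e₁ e₂ v) := by
  simp only [orr, sat_nt, Fml.Sat]; tauto
theorem sat_iff (p q v) : (iffF p q).Sat e₁ e₂ v ↔ (p.Sat e₁ e₂ v ↔ q.Sat e₁ e₂ v) := by
  simp only [iffF, sat_an, Fml.Sat]; tauto
theorem sat_ex (n p v) : (ex n p).Sat e₁ e₂ v ↔ ∃ a, p.Sat e₁ e₂ (Function.update v n a) := by
  simp only [ex, sat_nt, Fml.Sat]; push Not; rfl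

/-- The formula `f(a) = b` in the sense of `∈₁`, for variables below `10`. -/
def funF (f a b : ℕ) : Fml :=
  ex 12 (an (.mem1 12 f) (ex 11 (ex 13 (an
    (.all 10 (iffF (.mem1 10 11) (.eq 10 a)))
    (an (.all 10 (iffF (.mem1 10 13) (orr (.eq 10 a) (.eq 10 b))))
      (.all 10 (iffF (.mem1 10 12) (orr (.eq 10 11) (.eq 10 13)))))))))

theorem sat_funF (f a b : ℕ) (hf : f < 10) (ha : a < 10) (hb : b < 10) (v : ℕ → M) :
    (funF f a b).Sat e₁ e₂ v ↔ FunVal e₁ (v f) (v a) (v b) := by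
  have h : ∀ k, k < 10 → k ≠ 10 ∧ k ≠ 11 ∧ k ≠ 12 ∧ k ≠ 13 := by omega
  obtain ⟨f0, f1, f2, f3⟩ := h f hf
  obtain ⟨a0, a1, a2, a3⟩ := h a ha
  obtain ⟨b0, b1, b2, b3⟩ := h b hb
  simp only [funF, sat_ex, sat_an, sat_iff, sat_orr, Fml.Sat, FunVal, IsOPair, IsSingleton]
  simp [Function.update_apply, *]

/-- separation for (a) -/
theorem sepA {e : M → M → Prop} (h : SeparationSchema e e₁ e₂) (d f g : M) :
    ∃ b, ∀ t, e t b ↔ e t d ∧ ∃ p q, FunVal e₁ f t p ∧ FunVal e₁ g t q ∧ p ≠ q := by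
  obtain ⟨b, hb⟩ := h (ex 1 (ex 2 (an (funF 3 0 1) (an (funF 4 0 2) (nt (.eq 1 2))))))
    (fun n => if n = 3 then f else g) d
  refine ⟨b, fun t => (hb t).trans ?_⟩
  simp only [sat_ex, sat_an, sat_nt, Fml.Sat]
  simp [sat_funF, Function.update_apply]

theorem sepB {e : M → M → Prop} (h : SeparationSchema e e₁ e₂) (d f g k l : M) :
    ∃ b, ∀ t, e t b ↔ e t d ∧ ∃ p q, e₁ p k ∧ e₁ q l ∧
      FunVal e₁ f p t ∧ FunVal e₁ g q t ∧ p ≠ q := by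
  obtain ⟨b, hb⟩ := h (ex 1 (ex 2 (an (.mem1 1 5) (an (.mem1 2 6)
      (an (funF 3 1 0) (an (funF 4 2 0) (nt (.eq 1 2))))))))
    (fun n => if n = 3 then f else if n = 4 then g else if n = 5 then k else l) d
  refine ⟨b, fun t => (hb t).trans ?_⟩
  simp only [sat_ex, sat_an, sat_nt, Fml.Sat]
  simp [sat_funF, Function.update_apply]

theorem adjoin {e : M → M → Prop} (hp : Pairing e) (hu : UnionAx e) (a x : M) :
    ∃ b, ∀ t, e t b ↔ (e t a ∨ t = x) := by
  obtain ⟨s, hs⟩ := hp x x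
  obtain ⟨p, hp⟩ := hp a s
  obtain ⟨u, hu⟩ := hu p
  refine ⟨u, fun t => ?_⟩
  rw [hu]
  simp [hp, hs]

theorem tc_sing {e : M → M → Prop} (hp : Pairing e) (hu : UnionAx e) {x sx tcsx tcx : M}
    (h1 : IsSingleton e x sx) (h2 : IsTC e sx tcsx) (h3 : IsTC e x tcx) (t : M) :
    e t tcsx ↔ (e t tcx ∨ t = x) := by
  have hx : e x tcsx := h2.2.1 x ((h1 x).2 rfl)
  constructor
  · obtain ⟨b, hb⟩ := adjoin hp hu tcx x
    intro ht
    refine (hb t).1 (h2.2.2 b ?_ ?_ t ht)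
    · intro s hs w hw
      rw [hb] at hs ⊢
      rcases hs with hs | rfl
      · exact Or.inl (h3.1 s hs w hw)
      · exact Or.inl (h3.2.1 w hw)
    · intro w hw
      exact (hb w).2 (Or.inr ((h1 w).1 hw))
  · rintro (ht | rfl)
    · exact h3.2.2 tcsx h2.1 (fun w hw => h2.1 x hx w hw) t ht
    · exact hx

end

theorem partA {M : Type u} (Z : ZFC2Model M) (x y y' : M)
    (h : Phi Z.mem1 Z.mem2 x y) (h' : Phi Z.mem1 Z.mem2 x y') : y = y' := by
  obtain ⟨f, sx, D, T, U, s1, s2, s3, s4, hi, hii, hiii, hiv, hv⟩ := h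
  obtain ⟨f', sx', D', T', U', s1', s2', s3', s4', hi', hii', hiii', hiv', hv'⟩ := h'
  have hD := tc_sing Z.pair1 Z.union1 s1 s2 s3
  have hD' := tc_sing Z.pair1 Z.union1 s1' s2' s3'
  have hT : ∀ t, Z.mem1 t T ↔ Z.mem1 t T' := fun t =>
    ⟨s3.2.2 T' s3'.1 s3'.2.1 t, s3'.2.2 T s3.1 s3.2.1 t⟩
  obtain ⟨B, hB⟩ := sepA Z.mem1 Z.mem2 Z.sep1 D f f'
  by_contra hne
  obtain ⟨t, htB, hmin⟩ := Z.found1 B ⟨x, (hB x).2 ⟨(hD x).2 (Or.inr rfl), y, y', hv, hv', hne⟩⟩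
  obtain ⟨htD, a, b, ha, hb, hab⟩ := (hB t).1 htB
  have htD' : Z.mem1 t D' := by rw [hD', ← hT, ← hD]; exact htD
  have eqw : ∀ w, Z.mem1 w t → Z.mem1 w T → ∀ p q, FunVal Z.mem1 f w p → FunVal Z.mem1 f' w q →
      p = q := by
    intro w hwt hw p q hp hq
    by_contra hpq
    exact hmin w hwt ((hB w).2 ⟨(hD w).2 (Or.inl hw), p, q, hp, hq, hpq⟩)
  apply hab
  apply Z.ext2
  intro s
  constructor
  · intro hs
    have hsU : Z.mem2 s U := by
      rcases (hD t).1 htD with h | rfl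
      · exact s4.1 a (hii t h a ha) s hs
      · rw [hi.2.2 _ _ _ ha hv] at hs
        exact s4.2.1 s hs
    obtain ⟨w, hw, hfw⟩ := hiii s hsU
    have hwt := (hiv w hw t htD s a hfw ha).2 hs
    obtain ⟨q, hq⟩ := hi'.2.1 w ((hD' w).2 (Or.inl ((hT w).1 hw)))
    obtain rfl := eqw w hwt hw s q hfw hq
    exact (hiv' w ((hT w).1 hw) t htD' s b hq hb).1 hwt
  · intro hs
    have hsU : Z.mem2 s U' := by
      rcases (hD' t).1 htD' with h | rfl
      · exact s4'.1 b (hii' t h b hb) s hs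
      · rw [hi'.2.2 _ _ _ hb hv'] at hs
        exact s4'.2.1 s hs
    obtain ⟨w, hw, hfw⟩ := hiii' s hsU
    have hwt := (hiv' w hw t htD' s b hfw hb).2 hs
    have hwT := (hT w).2 hw
    obtain ⟨q, hq⟩ := hi.2.1 w ((hD w).2 (Or.inl hwT))
    obtain rfl := eqw w hwt hwT q s hq hfw
    exact (hiv w hwT t htD q a hq ha).1 hwt

theorem partB {M : Type u} (Z : ZFC2Model M) (x x' y : M)
    (h : Phi Z.mem1 Z.mem2 x y) (h' : Phi Z.mem1 Z.mem2 x' y) : x = x' := by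
  obtain ⟨f, sx, D, T, U, s1, s2, s3, s4, hi, hii, hiii, hiv, hv⟩ := h
  obtain ⟨f', sx', D', T', U', s1', s2', s3', s4', hi', hii', hiii', hiv', hv'⟩ := h'
  have hD := tc_sing Z.pair1 Z.union1 s1 s2 s3
  have hD' := tc_sing Z.pair1 Z.union1 s1' s2' s3'
  have hU : ∀ t, Z.mem2 t U ↔ Z.mem2 t U' := fun t =>
    ⟨s4.2.2 U' s4'.1 s4'.2.1 t, s4'.2.2 U s4.1 s4.2.1 t⟩
  obtain ⟨V, hV⟩ := adjoin Z.pair2 Z.union2 U y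
  obtain ⟨B, hB⟩ := sepB Z.mem1 Z.mem2 Z.sep2 V f f' D D'
  by_contra hne
  obtain ⟨s, hsB, hmin⟩ := Z.found2 B ⟨y, (hB y).2 ⟨(hV y).2 (Or.inr rfl), x, x',
    (hD x).2 (Or.inr rfl), (hD' x').2 (Or.inr rfl), hv, hv', hne⟩⟩
  obtain ⟨hsV, a, b, haD, hbD, ha, hb, hab⟩ := (hB s).1 hsB
  have eqw : ∀ r, Z.mem2 r s → Z.mem2 r U → ∀ p q, Z.mem1 p T → Z.mem1 q T' →
      FunVal Z.mem1 f p r → FunVal Z.mem1 f' q r → p = q := by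
    intro r hrs hr p q hp hq hfp hfq
    by_contra hpq
    exact hmin r hrs ((hB r).2 ⟨(hV r).2 (Or.inl hr), p, q, (hD p).2 (Or.inl hp),
      (hD' q).2 (Or.inl hq), hfp, hfq, hpq⟩)
  apply hab
  apply Z.ext1
  intro w
  constructor
  · intro hw
    have hwT : Z.mem1 w T := by
      rcases (hD a).1 haD with h | rfl
      · exact s3.1 a h w hw
      · exact s3.2.1 w hw
    obtain ⟨r, hr⟩ := hi.2.1 w ((hD w).2 (Or.inl hwT))
    have hrs := (hiv w hwT a haD r s hr ha).1 hw
    have hrU := hii w hwT r hr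
    obtain ⟨w', hw', hfw'⟩ := hiii' r ((hU r).1 hrU)
    obtain rfl := eqw r hrs hrU w w' hwT hw' hr hfw'
    exact (hiv' w hw' b hbD r s hfw' hb).2 hrs
  · intro hw
    have hwT : Z.mem1 w T' := by
      rcases (hD' b).1 hbD with h | rfl
      · exact s3'.1 b h w hw
      · exact s3'.2.1 w hw
    obtain ⟨r, hr⟩ := hi'.2.1 w ((hD' w).2 (Or.inl hwT))
    have hrs := (hiv' w hwT b hbD r s hr hb).1 hw
    have hrU := (hU r).2 (hii' w hwT r hr)
    obtain ⟨w', hw', hfw'⟩ := hiii r hrU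
    obtain rfl := eqw r hrs hrU w' w hw' hwT hfw' hr
    exact (hiv w' hw' a haD r s hfw' ha).2 hrs

end PhiAux

/-- In a model of `ZFC(∈₁) ∪ ZFC(∈₂)`, the class relation defined by
`φ(x, y)` is functional and injective: (a) if `φ(x, y)` and `φ(x, y')`
then `y = y'`; (b) if `φ(x, y)` and `φ(x', y)` then `x = x'`. -/
theorem phi_functional_injective {M : Type u} (Z : ZFC2Model M) :
    (∀ x y y' : M, Phi Z.mem1 Z.mem2 x y → Phi Z.mem1 Z.mem2 x y' → y = y') ∧
    (∀ x x' y : M, Phi Z.mem1 Z.mem2 x y → Phi Z.mem1 Z.mem2 x' y → x = x') := by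
  exact ⟨PhiAux.partA Z, PhiAux.partB Z⟩
end

section
/- Let M be a model of ZFC(∈₁) ∪ ZFC(∈₂). Suppose φ(α,y) holds in M for elements α, y of M. Then: (a) On₁(α) holds if and only if On₂(y) holds; and (b) if ∀u ∈₁ α ∃v ∈₁ α (u ∈₁ v) (i.e. α is an ∈₁-limit ordinal), then ∀u ∈₂ y ∃v ∈₂ y (u ∈₂ v) (i.e. y is an ∈₂-limit ordinal), and vice versa. -/
universe u

/-- In a model of `ZFC(∈₁) ∪ ZFC(∈₂)`, suppose `φ(α, y)` holds. Then:
(a) `On₁(α)` holds if and only if `On₂(y)` holds; and (b) `α` is an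
`∈₁`-limit ordinal (i.e. `∀u ∈₁ α ∃v ∈₁ α (u ∈₁ v)`) if and only if `y`
is an `∈₂`-limit ordinal (i.e. `∀u ∈₂ y ∃v ∈₂ y (u ∈₂ v)`). -/
theorem phi_preserves_ordinals {M : Type u} (Z : ZFC2Model M) (α y : M)
    (h : Phi Z.mem1 Z.mem2 α y) :
    (IsOrd Z.mem1 α ↔ IsOrd Z.mem2 y) ∧
    ((∀ u, Z.mem1 u α → ∃ v, Z.mem1 v α ∧ Z.mem1 u v) ↔
      (∀ u, Z.mem2 u y → ∃ v, Z.mem2 v y ∧ Z.mem2 u v)) := by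
  obtain ⟨f, sx, S, T, U, hsx, hS, hT, hU, hf, hin, hon, hiff, hxy⟩ := h
  have hxS : Z.mem1 α S := hS.2.1 α ((hsx α).2 rfl)
  have hTS : ∀ w, Z.mem1 w T → Z.mem1 w S := hT.2.2 S hS.1 (hS.1 α hxS)
  -- every element of `T` has a value
  have hval : ∀ t, Z.mem1 t T → ∃ b, FunVal Z.mem1 f t b := fun t ht => hf.2.1 t (hTS t ht)
  -- forward transfer of elements of `α`, and of elements of elements of `T`
  have fwdx : ∀ t, Z.mem1 t α → ∀ b, FunVal Z.mem1 f t b → Z.mem2 b y := fun t ht b hb =>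
    (hiff t (hT.2.1 t ht) α hxS b y hb hxy).1 ht
  have bwdx : ∀ t, Z.mem1 t T → ∀ b, FunVal Z.mem1 f t b → Z.mem2 b y → Z.mem1 t α :=
    fun t ht b hb h => (hiff t ht α hxS b y hb hxy).2 h
  have prex : ∀ b, Z.mem2 b y → ∃ t, Z.mem1 t T ∧ Z.mem1 t α ∧ FunVal Z.mem1 f t b := by
    intro b hb
    obtain ⟨t, ht, htb⟩ := hon b (hU.2.1 b hb)
    exact ⟨t, ht, bwdx t ht b htb hb, htb⟩
  have hT' : ∀ t, Z.mem1 t T → ∀ w, Z.mem1 w T → ∀ a b, FunVal Z.mem1 f t a →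
      FunVal Z.mem1 f w b → (Z.mem1 t w ↔ Z.mem2 a b) :=
    fun t ht w hw => hiff t ht w (hTS w hw)
  have pre : ∀ t, Z.mem1 t T → ∀ a, FunVal Z.mem1 f t a → ∀ b, Z.mem2 b a →
      ∃ w, Z.mem1 w T ∧ Z.mem1 w t ∧ FunVal Z.mem1 f w b := by
    intro t ht a hta b hba
    obtain ⟨w, hw, hwb⟩ := hon b (hU.1 a (hin t ht a hta) b hba)
    exact ⟨w, hw, (hT' w hw t ht b a hwb hta).2 hba, hwb⟩
  refine ⟨⟨fun h => ⟨?_, ?_⟩, fun h => ⟨?_, ?_⟩⟩, fun h => ?_, fun h => ?_⟩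
  · intro a ha b hb
    obtain ⟨t, htT, ht, hta⟩ := prex a ha
    obtain ⟨w, hwT, hw, hwb⟩ := pre t htT a hta b hb
    exact fwdx w (h.1 t ht w hw) b hwb
  · intro c hc a ha b hb
    obtain ⟨r, hrT, hr, hrc⟩ := prex c hc
    obtain ⟨t, htT, ht, hta⟩ := pre r hrT c hrc a ha
    obtain ⟨w, hwT, hw, hwb⟩ := pre t htT a hta b hb
    exact (hT' w hwT r hrT b c hwb hrc).1 (h.2 r hr t ht w hw)
  · intro t ht w hw
    have htT := hT.2.1 t ht
    have hwT := hT.1 t htT w hw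
    obtain ⟨a, ha⟩ := hval t htT
    obtain ⟨b, hb⟩ := hval w hwT
    exact bwdx w hwT b hb (h.1 a (fwdx t ht a ha) b ((hT' w hwT t htT b a hb ha).1 hw))
  · intro r hr t ht w hw
    have hrT := hT.2.1 r hr
    have htT := hT.1 r hrT t ht
    have hwT := hT.1 t htT w hw
    obtain ⟨c, hc⟩ := hval r hrT
    obtain ⟨a, ha⟩ := hval t htT
    obtain ⟨b, hb⟩ := hval w hwT
    exact (hT' w hwT r hrT b c hb hc).2 (h.2 c (fwdx r hr c hc) a
      ((hT' t htT r hrT a c ha hc).1 ht) b ((hT' w hwT t htT b a hb ha).1 hw))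
  · intro b hb
    obtain ⟨w, hwT, hw, hwb⟩ := prex b hb
    obtain ⟨v, hv, hwv⟩ := h w hw
    have hvT := hT.2.1 v hv
    obtain ⟨a, ha⟩ := hval v hvT
    exact ⟨a, fwdx v hv a ha, (hT' w hwT v hvT b a hwb ha).1 hwv⟩
  · intro w hw
    have hwT := hT.2.1 w hw
    obtain ⟨b, hb⟩ := hval w hwT
    obtain ⟨a, ha, hba⟩ := h b (fwdx w hw b hb)
    obtain ⟨v, hvT, hv, hva⟩ := prex a ha
    exact ⟨v, hv, (hT' w hwT v hvT b a hb hva).2 hba⟩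
end
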